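/- For every real number c, lim_{n→∞} (n!/2) · Σ_{σ∈A_n} ( P^{*⌈(n−3/2)(log n + c)⌉}(σ) − (P′)^{*⌈((n−1)/2)(log n + c)⌉}(σ) )² = 0; that is, the distribution of the transpose top-2 with random shuffle after ⌈(n−3/2)(log n + c)⌉ steps and the distribution of the P′-walk after ⌈((n−1)/2)(log n + c)⌉ steps become asymptotically indistinguishable in the scaled ℓ² sense. -/

import Mathlib

open scoped Classical
open Filter

noncomputable def convolve {G : Type*} [Group G] [Fintype G] (α β : G → ℝ) : G → ℝ :=
  fun x => ∑ g : G, α g * β (g⁻¹ * x)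

noncomputable def convPow {G : Type*} [Group G] [Fintype G] (γ : G → ℝ) : ℕ → G → ℝ
  | 0 => fun x => if x = 1 then 1 else 0
  | k + 1 => convolve (convPow γ k) γ

noncomputable def tvDist {Ω : Type*} [Fintype Ω] (p q : Ω → ℝ) : ℝ :=
  (∑ ω : Ω, |p ω - q ω|) / 2

noncomputable def unif (Ω : Type*) [Fintype Ω] : Ω → ℝ := fun _ => 1 / (Fintype.card Ω)

/-- The transpose top-2 with random shuffle measure on `A_n`: mass `1/(2n-3)` on the
identity and on each 3-cycle of the form `(i, n-1, n)` or `(i, n, n-1)` with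
`1 ≤ i ≤ n-2`; these 3-cycles are exactly the 3-cycles whose support contains both
of the two largest points. -/
noncomputable def Pmeas (n : ℕ) : alternatingGroup (Fin n) → ℝ := fun π =>
  if (π : Equiv.Perm (Fin n)) = 1 then 1 / (2 * (n : ℝ) - 3)
  else if (π : Equiv.Perm (Fin n)).IsThreeCycle ∧
      (∀ x : Fin n, n - 2 ≤ (x : ℕ) → x ∈ (π : Equiv.Perm (Fin n)).support) then
    1 / (2 * (n : ℝ) - 3)
  else 0

/-- The measure `P'` on `A_n`: mass `1/(n-1)` on the identity and `1/(n-1)^2` on each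
3-cycle of the form `(i,j,n)` or `(j,i,n)` with `1 ≤ i < j ≤ n-1`; these are exactly
the 3-cycles whose support contains the largest point. -/
noncomputable def P'meas (n : ℕ) : alternatingGroup (Fin n) → ℝ := fun π =>
  if (π : Equiv.Perm (Fin n)) = 1 then 1 / ((n : ℝ) - 1)
  else if (π : Equiv.Perm (Fin n)).IsThreeCycle ∧
      (∀ x : Fin n, (x : ℕ) = n - 1 → x ∈ (π : Equiv.Perm (Fin n)).support) then
    1 / ((n : ℝ) - 1) ^ 2
  else 0

/-- The measure `Q` on `A_n` giving mass `3/(n(n-1)(n-2))` to every 3-cycle. -/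
noncomputable def Qmeas (n : ℕ) : alternatingGroup (Fin n) → ℝ := fun π =>
  if (π : Equiv.Perm (Fin n)).IsThreeCycle then
    3 / ((n : ℝ) * ((n : ℝ) - 1) * ((n : ℝ) - 2))
  else 0

section JMsec
open Equiv Equiv.Perm
variable {n : ℕ} {E : Type*} [NormedAddCommGroup E] [InnerProductSpace ℝ E]

noncomputable def JM (ρ : Equiv.Perm (Fin n) →* Module.End ℝ E) (p : Fin n) : Module.End ℝ E :=
  ∑ i ∈ Finset.Iio p, ρ (swap i p)

variable (ρ : Equiv.Perm (Fin n) →* Module.End ℝ E)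

lemma swap_app_swap (a b : Fin n) (v : E) : ρ (swap a b) (ρ (swap a b) v) = v := by
  rw [← Module.End.mul_apply, ← map_mul, swap_mul_self, map_one, Module.End.one_apply]

lemma swap_inner (hρ : ∀ g u v, inner ℝ (ρ g u) (ρ g v) = inner ℝ u v) (a b : Fin n) (u v : E) :
    inner ℝ (ρ (swap a b) u) v = inner ℝ u (ρ (swap a b) v) := by
  rw [← hρ (swap a b), swap_app_swap]

lemma JM_symm (hρ : ∀ g u v, inner ℝ (ρ g u) (ρ g v) = inner ℝ u v) (p : Fin n) :
    (JM ρ p).IsSymmetric := by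
  intro u v
  simp only [JM, LinearMap.sum_apply, sum_inner, inner_sum, swap_inner ρ hρ]

lemma Iio_succ_fin {p q : Fin n} (h : q.val + 1 = p.val) : Finset.Iio p = insert q (Finset.Iio q) := by
  ext x
  simp only [Finset.mem_Iio, Finset.mem_insert, Fin.lt_def, Fin.ext_iff]
  omega

lemma JM_rel {p q : Fin n} (h : q.val + 1 = p.val) :
    ρ (swap q p) * JM ρ p = JM ρ q * ρ (swap q p) + 1 := by
  rw [JM, Iio_succ_fin h, Finset.sum_insert (by simp), mul_add, ← map_mul, swap_mul_self, map_one,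
    add_comm, Finset.mul_sum, JM, Finset.sum_mul]
  congr 1
  refine Finset.sum_congr rfl fun i hi => ?_
  rw [← map_mul, ← map_mul]
  congr 1
  simp only [Finset.mem_Iio, Fin.lt_def] at hi
  have h1 : i ≠ q := by intro h; simp [h] at hi
  have h2 : i ≠ p := by intro h; subst h; omega
  rw [mul_swap_eq_swap_mul, swap_apply_right, swap_apply_of_ne_of_ne h1 h2]

lemma JM_rel' {p q : Fin n} (h : q.val + 1 = p.val) :
    JM ρ p * ρ (swap q p) = ρ (swap q p) * JM ρ q + 1 := by
  have h0 : ρ (swap q p) * ρ (swap q p) = 1 := by rw [← map_mul, swap_mul_self, map_one]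
  have := congrArg (fun X => ρ (swap q p) * X * ρ (swap q p)) (JM_rel ρ h)
  simp only [mul_add, add_mul, mul_one, ← mul_assoc, h0, one_mul] at this
  simp only [mul_assoc, h0, mul_one] at this
  simpa [mul_assoc] using this

lemma JM_comm_swap {p i j : Fin n} (hi : i < p) (hj : j < p) :
    ρ (swap i j) * JM ρ p = JM ρ p * ρ (swap i j) := by
  rw [JM, Finset.mul_sum, Finset.sum_mul]
  have hs : ∀ l, l < p → swap i j l < p := by
    intro l hl
    rw [swap_apply_def]; split_ifs <;> assumption
  refine Finset.sum_bij (fun l _ => swap i j l) (fun l hl => by simpa using hs l (by simpa using hl))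
    (fun a _ b _ h => by simpa using h) (fun b hb => ⟨swap i j b, by simpa using hs b (by simpa using hb), by simp⟩) ?_
  intro l hl
  rw [← map_mul, ← map_mul, mul_swap_eq_swap_mul, swap_apply_of_ne_of_ne hi.ne' hj.ne']

lemma JM_comm {p q : Fin n} (h : q < p) : Commute (JM ρ q) (JM ρ p) := by
  conv_lhs => rw [JM]
  refine Commute.sum_left _ _ _ fun i hi => ?_
  exact JM_comm_swap ρ ((Finset.mem_Iio.1 hi).trans h) h

/-- the basic two-by-two analysis -/
lemma JM_inner (hρ : ∀ g u v, inner ℝ (ρ g u) (ρ g v) = inner ℝ u v)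
    {p q : Fin n} (h : q.val + 1 = p.val) {v : E} {a b : ℝ}
    (ha : JM ρ p v = a • v) (hb : JM ρ q v = b • v) :
    (a - b) * inner ℝ v (ρ (swap q p) v) = inner ℝ v v := by
  have h1 := congrArg (fun X => inner ℝ v (X v)) (JM_rel ρ h)
  simp only [Module.End.mul_apply, ha, map_smul, inner_smul_right, LinearMap.add_apply, inner_add_right,
    Module.End.one_apply, ← JM_symm ρ hρ q v, hb, inner_smul_left] at h1
  simp at h1
  simp only [real_inner_self_eq_norm_sq]
  linarith

lemma JM_pair (hρ : ∀ g u v, inner ℝ (ρ g u) (ρ g v) = inner ℝ u v)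
    {p q : Fin n} (h : q.val + 1 = p.val) {v : E} (hv : v ≠ 0) {a b : ℝ}
    (ha : JM ρ p v = a • v) (hb : JM ρ q v = b • v) :
    (ρ (swap q p) v = v ∧ a = b + 1) ∨ (ρ (swap q p) v = -v ∧ a = b - 1) ∨
    ∃ t : ℝ, ρ (swap q p) v - t • v ≠ 0 ∧
      JM ρ q (ρ (swap q p) v - t • v) = a • (ρ (swap q p) v - t • v) := by
  have hi := JM_inner ρ hρ h ha hb
  have hvv : inner ℝ v v ≠ (0:ℝ) := by simpa using hv
  have hab : a - b ≠ 0 := by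
    intro h0; rw [h0, zero_mul] at hi; exact hvv hi.symm
  set t : ℝ := 1 / (a - b) with ht
  have hta : t * (a - b) = 1 := by rw [ht]; field_simp
  by_cases hw : ρ (swap q p) v - t • v = 0
  · have hsv : ρ (swap q p) v = t • v := sub_eq_zero.1 hw
    have hss := swap_app_swap ρ q p v
    rw [hsv, map_smul, hsv, smul_smul] at hss
    have htt : t * t = 1 := by
      have : (t * t - 1) • v = 0 := by rw [sub_smul, hss, one_smul, sub_self]
      rcases smul_eq_zero.1 this with h | h
      · linarith
      · exact absurd h hv
    rcases mul_self_eq_one_iff.1 htt with h1 | h1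
    · left
      rw [h1] at hsv hta
      refine ⟨by simpa using hsv, by linarith⟩
    · right; left
      rw [h1] at hsv hta
      refine ⟨by simpa using hsv, by linarith⟩
  · right; right
    refine ⟨t, hw, ?_⟩
    have h1 := congrArg (fun X => X v) (JM_rel ρ h)
    simp only [Module.End.mul_apply, ha, map_smul, LinearMap.add_apply, Module.End.one_apply] at h1
    have h2 : JM ρ q (ρ (swap q p) v) = a • ρ (swap q p) v - v := by rw [h1]; simp
    rw [map_sub, map_smul, h2, hb, smul_sub, smul_smul, smul_smul]
    have : a * t = 1 + t * b := by linarith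
    rw [this, add_smul, one_smul]
    abel

lemma JM_norm (hρ : ∀ g u v, inner ℝ (ρ g u) (ρ g v) = inner ℝ u v)
    (p : Fin n) {v : E} (hv : v ≠ 0) {a : ℝ} (ha : JM ρ p v = a • v) : |a| ≤ p.val := by
  have hn : ∀ g, ‖ρ g v‖ = ‖v‖ := by
    intro g
    have := hρ g v v
    rw [real_inner_self_eq_norm_sq, real_inner_self_eq_norm_sq] at this
    exact (pow_left_inj₀ (norm_nonneg _) (norm_nonneg _) two_ne_zero).1 this
  have h1 : ‖JM ρ p v‖ ≤ p.val * ‖v‖ := by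
    rw [JM, LinearMap.sum_apply]
    refine (norm_sum_le _ _).trans ?_
    simp [hn]
  rw [ha, norm_smul] at h1
  exact le_of_mul_le_mul_right h1 (norm_pos_iff.2 hv)

/-- an eigenvector inside an invariant nonzero subspace -/
lemma exists_eig [FiniteDimensional ℝ E] {T : Module.End ℝ E} (hT : T.IsSymmetric)
    (M : Submodule ℝ E) (hM : ∀ v ∈ M, T v ∈ M) {K : Submodule ℝ E}
    (hK : ∀ v ∈ M, ∀ b : ℝ, v ≠ 0 → T v = b • v → v ∈ K) : M ≤ K := by
  have hs := hT.restrict_invariant hM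
  have h1 := hs.orthogonalComplement_iSup_eigenspaces_eq_bot
  rw [Submodule.orthogonal_eq_bot_iff] at h1
  have h2 : (⨆ μ : ℝ, Module.End.eigenspace (T.restrict hM) μ) ≤ K.comap M.subtype := by
    refine iSup_le fun μ x hx => ?_
    rw [Module.End.mem_eigenspace_iff] at hx
    have hx' : T x.1 = μ • x.1 := congrArg Subtype.val hx
    by_cases h0 : x.1 = 0
    · simp [h0]
    · exact hK x.1 x.2 μ h0 hx'
  rw [h1] at h2
  intro v hv
  exact h2 (x := ⟨v, hv⟩) trivial

lemma JM_int [FiniteDimensional ℝ E] (hρ : ∀ g u v, inner ℝ (ρ g u) (ρ g v) = inner ℝ u v) :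
    ∀ m : ℕ, ∀ p : Fin n, p.val = m → ∀ v : E, v ≠ 0 → ∀ a : ℝ, JM ρ p v = a • v →
    ∃ z : ℤ, a = z := by
  intro m
  induction m with
  | zero =>
    intro p hp v hv a ha
    have := JM_norm ρ hρ p hv ha
    rw [hp] at this
    simp at this
    exact ⟨0, by simp [this]⟩
  | succ m ih =>
    intro p hp v hv a ha
    obtain ⟨q, hq⟩ : ∃ q : Fin n, q.val = m := ⟨⟨m, by omega⟩, rfl⟩
    have hqp : q.val + 1 = p.val := by omega
    by_contra hz
    have key : (Module.End.eigenspace (JM ρ p) a) ≤ (⊥ : Submodule ℝ E) := by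
      refine exists_eig (JM_symm ρ hρ q) _ ?_ ?_
      · intro v hv
        rw [Module.End.mem_eigenspace_iff] at hv ⊢
        have := congrArg (fun X => X v) (JM_comm ρ (p := p) (q := q) (by rw [Fin.lt_def]; omega)).eq
        simp only [Module.End.mul_apply] at this
        rw [← this, hv, map_smul]
      · intro v hv b hv0 hb
        rw [Module.End.mem_eigenspace_iff] at hv
        exfalso
        apply hz
        obtain ⟨z, hz⟩ := ih q hq v hv0 b hb
        rcases JM_pair ρ hρ hqp hv0 hv hb with h | h | ⟨t, h1, h2⟩
        · exact ⟨z + 1, by rw [h.2, hz]; simp⟩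
        · exact ⟨z - 1, by rw [h.2, hz]; simp⟩
        · exact ih q hq _ h1 a h2
    exact hv (by simpa using key (Module.End.mem_eigenspace_iff.2 ha))

/-- the step in the spectral bound -/
lemma JM_step [FiniteDimensional ℝ E] (hρ : ∀ g u v, inner ℝ (ρ g u) (ρ g v) = inner ℝ u v)
    (r : ℕ) {p q : Fin n} (hqp : q.val + 1 = p.val) (hr : r ≤ p.val + 1)
    (V : Submodule ℝ E) (hV : ∀ i j : Fin n, i ≤ p → j ≤ p → ∀ v ∈ V, ρ (swap i j) v ∈ V)
    (hinv : ∀ v ∈ V, (∀ i j : Fin n, i.val < r → j.val < r → ρ (swap i j) v = v) → v = 0)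
    (hq : ∀ v ∈ V, v ≠ 0 → ∀ b : ℝ, JM ρ q v = b • v → b ≤ (r : ℝ) - 2)
    (v : E) (hvV : v ∈ V) (hv : v ≠ 0) (a : ℝ) (ha : JM ρ p v = a • v) : a ≤ (r : ℝ) - 2 := by
  by_contra! hlt
  have hqp' : q < p := by rw [Fin.lt_def]; omega
  set s := ρ (swap q p) with hs
  have hM : ∀ i j : Fin n, i < p → j < p → ∀ v ∈ V ⊓ Module.End.eigenspace (JM ρ p) a,
      ρ (swap i j) v ∈ V ⊓ Module.End.eigenspace (JM ρ p) a := by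
    intro i j hi hj v hv
    rw [Submodule.mem_inf, Module.End.mem_eigenspace_iff] at hv ⊢
    refine ⟨hV i j hi.le hj.le v hv.1, ?_⟩
    have := congrArg (fun X => X v) (JM_comm_swap ρ hi hj)
    simp only [Module.End.mul_apply] at this
    rw [← this, hv.2, map_smul]
  have key : V ⊓ Module.End.eigenspace (JM ρ p) a ≤ LinearMap.ker (s - 1) := by
    refine exists_eig (JM_symm ρ hρ q) _ ?_ ?_
    · intro v hv
      have e : JM ρ q v = ∑ i ∈ Finset.Iio q, ρ (swap i q) v := by rw [JM, LinearMap.sum_apply]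
      rw [e]
      refine Submodule.sum_mem _ fun i hi => hM i q ((Finset.mem_Iio.1 hi).trans hqp') hqp' v hv
    · intro v hv b hv0 hb
      rw [Submodule.mem_inf, Module.End.mem_eigenspace_iff] at hv
      rcases JM_pair ρ hρ hqp hv0 hv.2 hb with h | h | ⟨t, h1, h2⟩
      · simp [hs, h.1]
      · exfalso
        have := hq v hv.1 hv0 b hb
        linarith
      · exfalso
        have := hq _ (Submodule.sub_mem _ (hV q p hqp'.le le_rfl v hv.1) (Submodule.smul_mem _ t hv.1)) h1 a h2
        linarith
  have hfix : ∀ v ∈ V ⊓ Module.End.eigenspace (JM ρ p) a, s v = v := by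
    intro v hv
    have := key hv
    simpa [sub_eq_zero] using this
  have hfix2 : ∀ v ∈ V ⊓ Module.End.eigenspace (JM ρ p) a, ∀ i, i ≤ p → ρ (swap i p) v = v := by
    intro v hv i hi
    rcases hi.lt_or_eq with hi | hi
    · by_cases hiq : i = q
      · rw [hiq]; exact hfix v hv
      have e : swap i p = swap i q * swap q p * swap i q := by
        rw [swap_comm i q, swap_comm q p, Equiv.swap_mul_swap_mul_swap hqp'.ne' hi.ne']
      rw [e, map_mul, map_mul, Module.End.mul_apply, Module.End.mul_apply,
        hfix _ (hM i q hi hqp' v hv), swap_app_swap]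
    · rw [hi, swap_self]; exact congrArg (fun X => X v) (map_one ρ)
  refine hv (hinv v hvV fun i j hi hj => ?_)
  have hvM : v ∈ V ⊓ Module.End.eigenspace (JM ρ p) a := ⟨hvV, Module.End.mem_eigenspace_iff.2 ha⟩
  have hi' : i ≤ p := by rw [Fin.le_def]; omega
  have hj' : j ≤ p := by rw [Fin.le_def]; omega
  by_cases hjp : j = p
  · rw [hjp]; exact hfix2 v hvM i hi'
  by_cases hip : i = p
  · rw [hip, swap_comm]; exact hfix2 v hvM j hj'
  by_cases hij : j = i
  · rw [hij, swap_self]; exact congrArg (fun X => X v) (map_one ρ)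
  have e : swap i j = swap i p * swap j p * swap i p := by
    rw [swap_comm i p, Equiv.swap_mul_swap_mul_swap hjp hij]
  rw [e, map_mul, map_mul, Module.End.mul_apply, Module.End.mul_apply, hfix2 v hvM i hi', hfix2 v hvM j hj',
    hfix2 v hvM i hi']

lemma JM_bound [FiniteDimensional ℝ E] (hρ : ∀ g u v, inner ℝ (ρ g u) (ρ g v) = inner ℝ u v)
    (r : ℕ) (V : Submodule ℝ E) 
    (hinv : ∀ v ∈ V, (∀ i j : Fin n, i.val < r → j.val < r → ρ (swap i j) v = v) → v = 0) :
    ∀ m : ℕ, ∀ p : Fin n, p.val = m → r ≤ p.val + 1 →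
    (∀ i j : Fin n, i ≤ p → j ≤ p → ∀ v ∈ V, ρ (swap i j) v ∈ V) →
    ∀ v ∈ V, v ≠ 0 → ∀ a : ℝ, JM ρ p v = a • v → a ≤ (r : ℝ) - 2 := by
  intro m
  induction m with
  | zero =>
    intro p hp hr hV v hvV hv a ha
    exfalso
    apply hv
    apply hinv v hvV
    intro i j hi hj
    have : i = j := by ext; omega
    rw [this, swap_self]; exact congrArg (fun X => X v) (map_one ρ)
  | succ m ih =>
    intro p hp hr hV
    obtain ⟨q, hq⟩ : ∃ q : Fin n, q.val = m := ⟨⟨m, by omega⟩, rfl⟩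
    have hqp : q.val + 1 = p.val := by omega
    refine JM_step ρ hρ r hqp hr V hV hinv ?_
    rcases Nat.lt_or_ge p.val r with h | h
    · intro v hvV hv b hb
      have h1 := (abs_le.1 (JM_norm ρ hρ q hv hb)).2
      have : ((q.val : ℝ)) = r - 2 := by
        have : r = q.val + 2 := by omega
        rw [this]; push_cast; ring
      linarith
    · refine ih q hq (by omega) fun i j hi hj => hV i j ?_ ?_
      · rw [Fin.le_def] at *; omega
      · rw [Fin.le_def] at *; omega

end JMsec
section RegSec
open Equiv Equiv.Perm

noncomputable def regRep {n : ℕ} (χ : Equiv.Perm (Fin n) →* ℤˣ) :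
    Equiv.Perm (Fin n) →* Module.End ℝ (EuclideanSpace ℝ (Equiv.Perm (Fin n))) where
  toFun g :=
    { toFun := fun f => WithLp.toLp 2 (fun x => (((χ g : ℤˣ) : ℤ) : ℝ) * f (g⁻¹ * x))
      map_add' := by intro f f'; ext x; simp [mul_add]
      map_smul' := by intro c f; ext x; simp; ring }
  map_one' := by ext f x; simp
  map_mul' := by intro g h; ext f x; simp [mul_assoc]

lemma regRep_apply {n : ℕ} (χ : Equiv.Perm (Fin n) →* ℤˣ) (g x : Equiv.Perm (Fin n))
    (f : EuclideanSpace ℝ (Equiv.Perm (Fin n))) :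
    regRep χ g f x = (((χ g : ℤˣ) : ℤ) : ℝ) * f (g⁻¹ * x) := rfl

lemma units_cast_sq (u : ℤˣ) : ((u : ℤ) : ℝ) * ((u : ℤ) : ℝ) = 1 := by
  rcases Int.units_eq_one_or u with h | h <;> simp [h]

lemma regRep_inner {n : ℕ} (χ : Equiv.Perm (Fin n) →* ℤˣ) (g : Equiv.Perm (Fin n))
    (u v : EuclideanSpace ℝ (Equiv.Perm (Fin n))) :
    inner ℝ (regRep χ g u) (regRep χ g v) = inner ℝ u v := by
  simp only [PiLp.inner_apply, regRep_apply]
  rw [← Equiv.sum_comp (Equiv.mulLeft g⁻¹) (fun x => inner ℝ (u x) (v x))]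
  refine Finset.sum_congr rfl fun x _ => ?_
  simp only [Equiv.coe_mulLeft, RCLike.inner_apply, conj_trivial]
  have := units_cast_sq (χ g)
  linear_combination (v (g⁻¹ * x) * u (g⁻¹ * x)) * this

/-- vectors fixed by all transpositions inside `A` -/
def InvS {n : ℕ} (χ : Equiv.Perm (Fin n) →* ℤˣ) (A : Finset (Fin n)) :
    Submodule ℝ (EuclideanSpace ℝ (Equiv.Perm (Fin n))) where
  carrier := {f | ∀ i ∈ A, ∀ j ∈ A, regRep χ (swap i j) f = f}
  add_mem' := by
    intro a b ha hb i hi j hj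
    rw [map_add, ha i hi j hj, hb i hi j hj]
  zero_mem' := by intro i hi j hj; simp
  smul_mem' := by
    intro c a ha i hi j hj
    rw [map_smul, ha i hi j hj]

lemma InvS_fix {n : ℕ} (χ : Equiv.Perm (Fin n) →* ℤˣ) (A : Finset (Fin n))
    {f : EuclideanSpace ℝ (Equiv.Perm (Fin n))} (hf : f ∈ InvS χ A) (g : Equiv.Perm (Fin n))
    (hg : ∀ x, x ∉ A → g x = x) : regRep χ g f = f := by
  have key : ∀ h : Equiv.Perm {x // x ∈ A}, regRep χ (ofSubtype h) f = f := by
    intro h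
    induction h using Equiv.Perm.swap_induction_on with
    | one => simp
    | swap_mul h x y hxy ih =>
      rw [map_mul, map_mul, Module.End.mul_apply, ih, ofSubtype_swap_eq]
      exact hf x.1 x.2 y.1 y.2
  have h1 : ∀ x, g x ∈ A ↔ x ∈ A := by
    intro x
    constructor
    · intro h
      by_contra h2
      rw [hg x h2] at h
      exact h2 h
    · intro h
      by_contra h2
      have := g.injective (hg _ h2)
      rw [this] at h2
      exact h2 h
  have := key (g.subtypePerm h1)
  rwa [ofSubtype_subtypePerm] at this
  intro x hx
  by_contra h2
  exact hx (hg x h2)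

lemma InvS_finrank {n : ℕ} (χ : Equiv.Perm (Fin n) →* ℤˣ) (A : Finset (Fin n)) :
    Module.finrank ℝ (InvS χ A) ≤ n.descFactorial (n - A.card) := by
  let ι := ({x // x ∉ A} ↪ Fin n)
  let res : Equiv.Perm (Fin n) → ι := fun x => (Function.Embedding.subtype _).trans (x⁻¹).toEmbedding
  let s : ι → Equiv.Perm (Fin n) := fun e => if h : ∃ x, res x = e then h.choose else 1
  have hs : ∀ x, res (s (res x)) = res x := by
    intro x
    have h : ∃ y, res y = res x := ⟨x, rfl⟩
    simp only [s, dif_pos h]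
    exact h.choose_spec
  let Φ : InvS χ A →ₗ[ℝ] (ι → ℝ) :=
    { toFun := fun f e => f.1 (s e)
      map_add' := by intro f g; ext e; simp
      map_smul' := by intro c g; ext e; simp }
  have hinj : Function.Injective Φ := by
    rw [← LinearMap.ker_eq_bot, LinearMap.ker_eq_bot']
    intro f hf
    ext x
    have h1 : f.1 (s (res x)) = 0 := congrFun hf (res x)
    have h2 := InvS_fix χ A f.2 (x * (s (res x))⁻¹) (by
      intro y hy
      have := DFunLike.congr_fun (hs x) ⟨y, hy⟩
      have h3 : (s (res x))⁻¹ y = x⁻¹ y := this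
      rw [Equiv.Perm.mul_apply, h3]; exact x.apply_symm_apply y)
    have h3 := congrArg (fun F => F x) h2
    simp only [regRep_apply, mul_inv_rev, inv_inv, inv_mul_cancel_right, h1, mul_zero] at h3
    simpa using h3.symm
  have := LinearMap.finrank_le_finrank_of_injective hinj
  refine this.trans (le_of_eq ?_)
  rw [Module.finrank_fintype_fun_eq_card, Fintype.card_embedding_eq]
  simp [Fintype.card_subtype_compl]

lemma finrank_sup_le {α F : Type*} [AddCommGroup F] [Module ℝ F] [FiniteDimensional ℝ F]
    (s : Finset α) (f : α → Submodule ℝ F) (B : ℕ) (hB : ∀ a ∈ s, Module.finrank ℝ (f a) ≤ B) :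
    Module.finrank ℝ (s.sup f : Submodule ℝ F) ≤ s.card * B := by
  induction s using Finset.induction_on with
  | empty => simp
  | insert a s ha ih =>
    rw [Finset.sup_insert, Finset.card_insert_of_notMem ha]
    have h1 := Submodule.finrank_add_le_finrank_add_finrank (f a) (s.sup f)
    have h2 := ih fun b hb => hB b (Finset.mem_insert_of_mem hb)
    have h3 := hB a (Finset.mem_insert_self _ _)
    linarith

lemma InvS_swap {n : ℕ} (χ : Equiv.Perm (Fin n) →* ℤˣ) (A : Finset (Fin n)) (g : Equiv.Perm (Fin n))
    {f : EuclideanSpace ℝ (Equiv.Perm (Fin n))} (hf : f ∈ InvS χ A) :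
    regRep χ g f ∈ InvS χ (A.map g.toEmbedding) := by
  intro i hi j hj
  rw [Finset.mem_map] at hi hj
  obtain ⟨i, hi, rfl⟩ := hi
  obtain ⟨j, hj, rfl⟩ := hj
  have : swap (g i) (g j) * g = g * swap i j := by rw [mul_swap_eq_swap_mul]
  simp only [Equiv.coe_toEmbedding]
  rw [← Module.End.mul_apply, ← map_mul, this, map_mul, Module.End.mul_apply, hf i hi j hj]

lemma JM_mult {n : ℕ} (χ : Equiv.Perm (Fin n) →* ℤˣ) (p : Fin n) (r : ℕ) (hr : r ≤ p.val + 1)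
    {ι : Type*} (s : Finset ι) (v : ι → EuclideanSpace ℝ (Equiv.Perm (Fin n)))
    (hv : Orthonormal ℝ v) (a : ι → ℝ) (hJ : ∀ i ∈ s, JM (regRep χ) p (v i) = a i • v i)
    (ha : ∀ i ∈ s, (r : ℝ) - 2 < a i) :
    s.card ≤ (p.val + 1).choose r * n.descFactorial (n - r) := by
  set W : Submodule ℝ (EuclideanSpace ℝ (Equiv.Perm (Fin n))) :=
    (Finset.powersetCard r (Finset.Iic p)).sup (InvS χ) with hW
  have hWfin : Module.finrank ℝ W ≤ (p.val + 1).choose r * n.descFactorial (n - r) := by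
    refine (finrank_sup_le _ _ (n.descFactorial (n - r)) ?_).trans ?_
    · intro A hA
      have := InvS_finrank χ A
      rwa [(Finset.mem_powersetCard.1 hA).2] at this
    · rw [Finset.card_powersetCard, Fin.card_Iic]
  have hρ := regRep_inner χ
  have hWinv : ∀ i j : Fin n, i ≤ p → j ≤ p → ∀ v ∈ W, regRep χ (swap i j) v ∈ W := by
    intro i j hi hj
    change W ≤ W.comap (regRep χ (swap i j))
    conv_lhs => rw [hW]
    refine Finset.sup_le fun A hA f hf => ?_
    have h1 := InvS_swap χ A (swap i j) hf
    rw [Finset.mem_powersetCard] at hA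
    have h2 : A.map (swap i j).toEmbedding ∈ Finset.powersetCard r (Finset.Iic p) := by
      rw [Finset.mem_powersetCard, Finset.card_map]
      refine ⟨?_, hA.2⟩
      intro x hx
      rw [Finset.mem_map] at hx
      obtain ⟨y, hy, rfl⟩ := hx
      have hy' := Finset.mem_Iic.1 (hA.1 hy)
      simp only [Equiv.coe_toEmbedding, Finset.mem_Iic]
      rw [swap_apply_def]; split_ifs <;> assumption
    exact (Finset.le_sup (f := InvS χ) h2) h1
  have hWo : ∀ i j : Fin n, i ≤ p → j ≤ p → ∀ v ∈ Wᗮ, regRep χ (swap i j) v ∈ Wᗮ := by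
    intro i j hi hj v hv
    rw [Submodule.mem_orthogonal] at hv ⊢
    intro u hu
    rw [← swap_inner (regRep χ) hρ]
    exact hv _ (hWinv i j hi hj u hu)
  have hJW : ∀ V : Submodule ℝ (EuclideanSpace ℝ (Equiv.Perm (Fin n))),
      (∀ i j : Fin n, i ≤ p → j ≤ p → ∀ v ∈ V, regRep χ (swap i j) v ∈ V) →
      ∀ v ∈ V, JM (regRep χ) p v ∈ V := by
    intro V hV v hv
    rw [JM, LinearMap.sum_apply]
    exact Submodule.sum_mem _ fun i hi => hV i p (Finset.mem_Iio.1 hi).le le_rfl v hv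
  have hb := JM_bound (regRep χ) hρ r Wᗮ (by
    intro v hv hfix
    have h1 : v ∈ W := by
      have h2 : (Finset.univ.filter fun i : Fin n => i.val < r) ∈ Finset.powersetCard r (Finset.Iic p) := by
        rw [Finset.mem_powersetCard]
        constructor
        · intro x hx
          simp only [Finset.mem_filter, Finset.mem_univ, true_and] at hx
          rw [Finset.mem_Iic, Fin.le_def]; omega
        · rw [Fin.card_filter_val_lt]
          omega
      refine (Finset.le_sup (f := InvS χ) h2) ?_
      intro i hi j hj
      simp only [Finset.mem_filter, Finset.mem_univ, true_and] at hi hj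
      exact hfix i j hi hj
    have := (Submodule.mem_orthogonal _ _).1 hv v h1
    simpa using this) p.val p rfl hr hWo
  have hmem : ∀ i ∈ s, v i ∈ W := by
    intro i hi
    obtain ⟨w, hw, u, hu, hwu⟩ := Submodule.exists_add_mem_mem_orthogonal (K := W) (v i)
    have h1 := hJ i hi
    rw [hwu, map_add, smul_add] at h1
    have h2 : JM (regRep χ) p u - a i • u = a i • w - JM (regRep χ) p w := by
      rw [sub_eq_sub_iff_add_eq_add, ← h1, add_comm]
    have h3 : JM (regRep χ) p u - a i • u ∈ Wᗮ :=
      Submodule.sub_mem _ (hJW _ hWo u hu) (Submodule.smul_mem _ _ hu)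
    have h4 : JM (regRep χ) p u - a i • u ∈ W := by
      rw [h2]
      exact Submodule.sub_mem _ (Submodule.smul_mem _ _ hw) (hJW _ hWinv w hw)
    have h5 : JM (regRep χ) p u - a i • u = 0 := by
      have := (Submodule.mem_orthogonal _ _).1 h3 _ h4
      simpa using this
    by_cases hu0 : u = 0
    · rw [hwu, hu0, add_zero]; exact hw
    · have := hb u hu hu0 (a i) (sub_eq_zero.1 h5)
      linarith [ha i hi]
  have hli : LinearIndependent ℝ (fun i : s => (⟨v i, hmem i i.2⟩ : W)) := by
    apply LinearIndependent.of_comp W.subtype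
    exact (hv.linearIndependent.comp (Subtype.val : s → ι) Subtype.val_injective)
  have := hli.fintype_card_le_finrank
  simp at this
  exact this.trans hWfin

end RegSec
section OpSec
open Equiv Equiv.Perm

noncomputable def opT {n : ℕ} (φ : alternatingGroup (Fin n) → ℝ) :
    Module.End ℝ (EuclideanSpace ℝ (Equiv.Perm (Fin n))) :=
  ∑ g : alternatingGroup (Fin n), φ g • regRep 1 (g : Equiv.Perm (Fin n))

lemma opT_convolve {n : ℕ} (α β : alternatingGroup (Fin n) → ℝ) :
    opT (convolve α β) = opT α * opT β := by
  simp only [opT, convolve, Finset.sum_smul, Finset.sum_mul_sum]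
  rw [Finset.sum_comm]
  refine Finset.sum_congr rfl fun g _ => ?_
  rw [← Equiv.sum_comp (Equiv.mulLeft g)]
  refine Finset.sum_congr rfl fun h _ => ?_
  simp [smul_smul, mul_comm (β h)]

lemma opT_convPow {n : ℕ} (γ : alternatingGroup (Fin n) → ℝ) (k : ℕ) :
    opT (convPow γ k) = opT γ ^ k := by
  induction k with
  | zero =>
    simp only [convPow, opT, ite_smul, one_smul, zero_smul, pow_zero]
    rw [Finset.sum_ite_eq']
    simp
  | succ k ih => rw [convPow, opT_convolve, ih, pow_succ]

lemma opT_sub {n : ℕ} (α β : alternatingGroup (Fin n) → ℝ) :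
    opT (fun x => α x - β x) = opT α - opT β := by
  simp [opT, sub_smul]

lemma opT_norm {n : ℕ} (φ : alternatingGroup (Fin n) → ℝ) {ι : Type*} [Fintype ι]
    (b : OrthonormalBasis ι ℝ (EuclideanSpace ℝ (Equiv.Perm (Fin n)))) :
    ∑ i, ‖opT φ (b i)‖ ^ 2 = (n.factorial : ℝ) * ∑ σ, φ σ ^ 2 := by
  have h1 : ∀ {κ : Type _} [Fintype κ] (b : OrthonormalBasis κ ℝ (EuclideanSpace ℝ (Equiv.Perm (Fin n)))),
      LinearMap.trace ℝ _ (LinearMap.adjoint (opT φ) * opT φ) = ∑ i, ‖opT φ (b i)‖ ^ 2 := by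
    intro κ _ b
    rw [LinearMap.trace_eq_sum_inner _ b]
    refine Finset.sum_congr rfl fun i _ => ?_
    rw [Module.End.mul_apply, LinearMap.adjoint_inner_right, real_inner_self_eq_norm_sq]
  have h3 : LinearMap.trace ℝ _ (LinearMap.adjoint (opT φ) * opT φ) = ∑ i, ‖opT φ (b i)‖ ^ 2 := by
    rw [LinearMap.trace_eq_sum_inner _ b]
    refine Finset.sum_congr rfl fun i _ => ?_
    rw [Module.End.mul_apply, LinearMap.adjoint_inner_right, real_inner_self_eq_norm_sq]
  rw [← h3, h1 (EuclideanSpace.basisFun (Equiv.Perm (Fin n)) ℝ)]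
  have h2 : ∀ x : Equiv.Perm (Fin n),
      ‖opT φ (EuclideanSpace.basisFun (Equiv.Perm (Fin n)) ℝ x)‖ ^ 2 = ∑ σ, φ σ ^ 2 := by
    intro x
    have ho : Orthonormal ℝ (fun g : alternatingGroup (Fin n) =>
        EuclideanSpace.basisFun (Equiv.Perm (Fin n)) ℝ ((g : Equiv.Perm (Fin n)) * x)) := by
      refine (EuclideanSpace.basisFun (Equiv.Perm (Fin n)) ℝ).orthonormal.comp
        (fun g : alternatingGroup (Fin n) => (g : Equiv.Perm (Fin n)) * x) ?_
      intro g h hgh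
      exact Subtype.ext (mul_right_cancel hgh)
    have he : opT φ (EuclideanSpace.basisFun (Equiv.Perm (Fin n)) ℝ x) =
        ∑ g : alternatingGroup (Fin n), φ g •
          EuclideanSpace.basisFun (Equiv.Perm (Fin n)) ℝ ((g : Equiv.Perm (Fin n)) * x) := by
      rw [opT, LinearMap.sum_apply]
      refine Finset.sum_congr rfl fun g _ => ?_
      rw [LinearMap.smul_apply]
      congr 1
      ext y
      rw [regRep_apply]
      simp [PiLp.single_apply, inv_mul_eq_iff_eq_mul]
    rw [he, ← real_inner_self_eq_norm_sq, ho.inner_sum]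
    simp [sq]
  rw [Finset.sum_congr rfl fun x _ => h2 x]
  simp [Fintype.card_perm]

lemma threeCycle_form {n : ℕ} {g : Equiv.Perm (Fin n)} (hg : g.IsThreeCycle) {p : Fin n}
    (hp : p ∈ g.support) : g p ≠ p ∧ g (g p) ≠ p ∧ g (g p) ≠ g p ∧
      g = swap (g (g p)) p * swap (g p) p := by
  have h1 : g p ≠ p := by simpa using hp
  have h3 : g (g (g p)) = p := by
    have := pow_orderOf_eq_one g
    rw [hg.orderOf] at this
    have := DFunLike.congr_fun this p
    simpa [pow_succ] using this
  have h2 : g (g p) ≠ p := by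
    intro h
    rw [h] at h3
    exact h1 h3
  have h4 : g (g p) ≠ g p := fun h => h1 (g.injective h)
  refine ⟨h1, h2, h4, ?_⟩
  have hsub : ({p, g p, g (g p)} : Finset (Fin n)) ⊆ g.support := by
    intro x hx
    simp only [Finset.mem_insert, Finset.mem_singleton] at hx
    rcases hx with rfl | rfl | rfl
    · exact hp
    · simpa using h1
    · simpa using h1
  have hcard : ({p, g p, g (g p)} : Finset (Fin n)).card = 3 := by
    rw [Finset.card_eq_three]
    exact ⟨p, g p, g (g p), h1.symm, h2.symm, h4.symm, rfl⟩
  have heq := Finset.eq_of_subset_of_card_le hsub (by rw [hg.card_support, hcard])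
  ext x
  congr 1
  by_cases hxp : x = p
  · rw [hxp, Equiv.Perm.mul_apply, swap_apply_right, swap_apply_of_ne_of_ne h4.symm h1]
  by_cases hxj : x = g p
  · rw [hxj, Equiv.Perm.mul_apply, swap_apply_left, swap_apply_right]
  by_cases hxi : x = g (g p)
  · rw [hxi, Equiv.Perm.mul_apply, swap_apply_of_ne_of_ne h4 h2, swap_apply_left, h3]
  · rw [Equiv.Perm.mul_apply, swap_apply_of_ne_of_ne hxj hxp, swap_apply_of_ne_of_ne hxi hxp]
    have : x ∉ g.support := by
      rw [← heq]; simp [hxp, hxj, hxi]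
    simpa using this

lemma sum_threeCycle {n : ℕ} {M : Type*} [AddCommMonoid M] (F : Equiv.Perm (Fin n) → M) (p : Fin n)
    (hp : p.val = n - 1)
    (hF : ∀ g, g ≠ 1 → ¬ (g.IsThreeCycle ∧ p ∈ g.support) → F g = 0) :
    ∑ g : alternatingGroup (Fin n), F g = F 1 +
      ∑ i ∈ Finset.Iio p, ∑ j ∈ Finset.Iio p, if i ≠ j then F (swap i p * swap j p) else 0 := by
  have h0 : ∑ g : alternatingGroup (Fin n), F g = ∑ g : Equiv.Perm (Fin n), F g := by
    rw [← Finset.sum_filter_of_ne (p := fun g => g ∈ alternatingGroup (Fin n))]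
    · exact (Finset.sum_subtype _ (by simp) F).symm
    · intro g _ hg
      by_contra h
      apply hg
      apply hF
      · rintro rfl; exact h (one_mem _)
      · intro h3; exact h h3.1.mem_alternatingGroup
  have hlt : ∀ x : Fin n, x ∈ Finset.Iio p ↔ x ≠ p := by
    intro x
    have := x.2
    rw [Finset.mem_Iio, Fin.lt_def, Ne, Fin.ext_iff]
    omega
  have hval : ∀ i j : Fin n, i ≠ p → j ≠ p → i ≠ j → (swap i p * swap j p) p = j := by
    intro i j hi hj hij
    rw [Equiv.Perm.mul_apply, swap_apply_right, swap_apply_of_ne_of_ne hij.symm hj]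
  set f : Fin n × Fin n → Equiv.Perm (Fin n) := fun x => swap x.1 p * swap x.2 p with hf
  have hmem : ∀ x : Fin n × Fin n, x ∈ (Finset.Iio p).offDiag ↔ x.1 ≠ p ∧ x.2 ≠ p ∧ x.1 ≠ x.2 := by
    intro x
    rw [Finset.mem_offDiag, hlt, hlt]
  have hinj : Set.InjOn f ((Finset.Iio p).offDiag : Set (Fin n × Fin n)) := by
    intro x hx y hy hxy
    rw [Finset.mem_coe, hmem] at hx hy
    have h2 : x.2 = y.2 := by
      have := DFunLike.congr_fun hxy p
      rwa [hf, hval _ _ hx.1 hx.2.1 hx.2.2, hval _ _ hy.1 hy.2.1 hy.2.2] at this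
    simp only [hf] at hxy
    rw [h2] at hxy
    have h3 := DFunLike.congr_fun (mul_right_cancel hxy) p
    rw [swap_apply_right, swap_apply_right] at h3
    exact Prod.ext h3 h2
  have h1 : (1 : Equiv.Perm (Fin n)) ∉ (Finset.Iio p).offDiag.image f := by
    rw [Finset.mem_image]
    rintro ⟨x, hx, h⟩
    rw [hmem] at hx
    have := DFunLike.congr_fun h p
    rw [hf, hval _ _ hx.1 hx.2.1 hx.2.2] at this
    exact hx.2.1 this
  rw [h0, ← Finset.sum_subset (Finset.subset_univ (insert 1 ((Finset.Iio p).offDiag.image f))),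
    Finset.sum_insert h1, Finset.sum_image hinj]
  · congr 1
    have : (Finset.Iio p).offDiag = (Finset.Iio p ×ˢ Finset.Iio p).filter (fun x => x.1 ≠ x.2) := by
      ext x; simp [Finset.mem_offDiag, and_assoc]
    rw [this, Finset.sum_filter, Finset.sum_product]
  · intro g _ hg
    rw [Finset.mem_insert, not_or] at hg
    apply hF g hg.1
    rintro ⟨h3, h4⟩
    apply hg.2
    obtain ⟨e1, e2, e3, e4⟩ := threeCycle_form h3 h4
    rw [Finset.mem_image]
    exact ⟨(g (g p), g p), (hmem _).2 ⟨e2, e1, e3⟩, e4.symm⟩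

lemma swaps_three {n : ℕ} {i j p : Fin n} (hi : i ≠ p) (hj : j ≠ p) (hij : i ≠ j) :
    (swap i p * swap j p).IsThreeCycle ∧ (∀ x, x ∈ (swap i p * swap j p).support ↔ x = i ∨ x = j ∨ x = p) := by
  have h3 : (swap i p * swap j p).IsThreeCycle := by
    rw [swap_comm i p, swap_comm j p]
    exact isThreeCycle_swap_mul_swap_same hi.symm hj.symm hij
  refine ⟨h3, fun x => ?_⟩
  rw [Equiv.Perm.mem_support, Equiv.Perm.mul_apply]
  simp only [swap_apply_def]
  grind

lemma opT_P' {n : ℕ} (hn : 3 ≤ n) (p : Fin n) (hp : p.val = n - 1) :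
    opT (P'meas n) = (1 / ((n : ℝ) - 1) ^ 2) • (JM (regRep 1) p * JM (regRep 1) p) := by
  have hn' : (3 : ℝ) ≤ n := by exact_mod_cast hn
  have hx : ∀ x : Fin n, (x : ℕ) = n - 1 ↔ x = p := by
    intro x; rw [Fin.ext_iff]; omega
  let F : Equiv.Perm (Fin n) → ℝ := fun g =>
    if g = 1 then 1 / ((n : ℝ) - 1)
    else if g.IsThreeCycle ∧ p ∈ g.support then 1 / ((n : ℝ) - 1) ^ 2 else 0
  have h1 : opT (P'meas n) = ∑ g : alternatingGroup (Fin n), (fun g => F g • regRep 1 g) (g : Equiv.Perm (Fin n)) := by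
    rw [opT]
    refine Finset.sum_congr rfl fun g _ => ?_
    simp only [P'meas, F, hx, forall_eq]
  rw [h1]
  refine (sum_threeCycle (fun g => F g • regRep 1 g) p hp ?_).trans ?_
  · intro g hg h
    simp only [F, if_neg hg, if_neg h, zero_smul]
  beta_reduce
  have h2 : ∀ i ∈ Finset.Iio p, ∀ j ∈ Finset.Iio p,
      (if i ≠ j then F (swap i p * swap j p) • regRep (1 : Equiv.Perm (Fin n) →* ℤˣ) (swap i p * swap j p) else 0)
      = (1 / ((n : ℝ) - 1) ^ 2) • (regRep 1 (swap i p) * regRep 1 (swap j p)) - 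
        if i = j then (1 / ((n : ℝ) - 1) ^ 2) • (1 : Module.End ℝ (EuclideanSpace ℝ (Equiv.Perm (Fin n)))) else 0 := by
    intro i hi j hj
    rw [Finset.mem_Iio] at hi hj
    by_cases hij : i = j
    · subst hij
      simp [← map_mul]
    · have h3 := swaps_three hi.ne hj.ne hij
      have h4 : swap i p * swap j p ≠ 1 := by
        intro h
        have := (h3.2 p).2 (by simp)
        rw [h] at this; simp at this
      have h5 : F (swap i p * swap j p) = 1 / ((n : ℝ) - 1) ^ 2 := by
        simp only [F, if_neg h4]
        rw [if_pos ⟨h3.1, (h3.2 p).2 (by simp)⟩]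
      rw [if_pos hij, if_neg hij, h5, map_mul, sub_zero]
  rw [Finset.sum_congr rfl fun i hi => Finset.sum_congr rfl fun j hj => h2 i hi j hj]
  simp only [Finset.sum_sub_distrib, Finset.sum_ite_eq]
  rw [Finset.sum_ite_mem, Finset.inter_self, Finset.sum_const, Fin.card_Iio]
  have e1 : JM (regRep 1) p * JM (regRep 1) p = ∑ i ∈ Finset.Iio p, ∑ j ∈ Finset.Iio p,
    (regRep (1 : Equiv.Perm (Fin n) →* ℤˣ) (swap i p) * regRep 1 (swap j p)) := by
    rw [JM, Finset.sum_mul_sum]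
  rw [e1]
  simp only [← Finset.smul_sum]
  have e2 : F 1 = 1 / ((n : ℝ) - 1) := by simp [F]
  rw [e2, map_one, hp]
  have e3 : (n - 1) • (1 / ((n : ℝ) - 1) ^ 2) • (1 : Module.End ℝ (EuclideanSpace ℝ (Equiv.Perm (Fin n)))) = (1 / ((n : ℝ) - 1)) • 1 := by
    rw [← Nat.cast_smul_eq_nsmul ℝ, smul_smul]
    congr 1
    rw [Nat.cast_sub (by omega), Nat.cast_one]
    have : (n : ℝ) - 1 ≠ 0 := by linarith
    field_simp
  rw [e3]
  abel

lemma opT_P {n : ℕ} (hn : 3 ≤ n) (p q : Fin n) (hp : p.val = n - 1) (hqp : q.val + 1 = p.val) :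
    opT (Pmeas n) = (1 / (2 * (n : ℝ) - 3)) • (regRep 1 (swap q p) * (JM (regRep 1) p + JM (regRep 1) q)) := by
  have hn' : (3 : ℝ) ≤ n := by exact_mod_cast hn
  have hx : ∀ x : Fin n, n - 2 ≤ (x : ℕ) ↔ x = p ∨ x = q := by
    intro x; have := x.2; rw [Fin.ext_iff, Fin.ext_iff]; omega
  have hqp' : q ≠ p := by intro h; rw [h] at hqp; omega
  set C : ℝ := 1 / (2 * (n : ℝ) - 3) with hC
  let F : Equiv.Perm (Fin n) → ℝ := fun g =>
    if g = 1 then C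
    else if g.IsThreeCycle ∧ p ∈ g.support ∧ q ∈ g.support then C else 0
  have h1 : opT (Pmeas n) = ∑ g : alternatingGroup (Fin n), (fun g => F g • regRep 1 g) (g : Equiv.Perm (Fin n)) := by
    rw [opT]
    refine Finset.sum_congr rfl fun g _ => ?_
    simp only [Pmeas, F, hx, forall_eq_or_imp, forall_eq, hC]
  rw [h1]
  refine (sum_threeCycle (fun g => F g • regRep 1 g) p hp ?_).trans ?_
  · intro g hg h
    have : ¬ (g.IsThreeCycle ∧ p ∈ g.support ∧ q ∈ g.support) := fun h' => h ⟨h'.1, h'.2.1⟩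
    simp only [F, if_neg hg, if_neg this, zero_smul]
  beta_reduce
  have h2 : ∀ i ∈ Finset.Iio p, ∀ j ∈ Finset.Iio p,
      (if i ≠ j then F (swap i p * swap j p) • regRep (1 : Equiv.Perm (Fin n) →* ℤˣ) (swap i p * swap j p) else 0)
      = if i ≠ j ∧ (i = q ∨ j = q) then C • (regRep 1 (swap i p) * regRep 1 (swap j p)) else 0 := by
    intro i hi j hj
    rw [Finset.mem_Iio] at hi hj
    by_cases hij : i = j
    · subst hij
      simp
    · have h3 := swaps_three hi.ne hj.ne hij
      have h4 : swap i p * swap j p ≠ 1 := by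
        intro h
        have := (h3.2 p).2 (by simp)
        rw [h] at this; simp at this
      have h5 : F (swap i p * swap j p) = if i = q ∨ j = q then C else 0 := by
        simp only [F, if_neg h4, h3.1, h3.2, true_and, hqp', or_false, or_true]
        simp only [eq_comm]
      rw [if_pos hij, h5, map_mul]
      simp [hij]
  rw [Finset.sum_congr rfl fun i hi => Finset.sum_congr rfl fun j hj => h2 i hi j hj]
  have hJ : JM (regRep (1 : Equiv.Perm (Fin n) →* ℤˣ)) p = regRep 1 (swap q p) + ∑ i ∈ Finset.Iio q, regRep 1 (swap i p) := by
    rw [JM, Iio_succ_fin hqp, Finset.sum_insert (by simp)]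
  have hrel := JM_rel' (regRep (1 : Equiv.Perm (Fin n) →* ℤˣ)) hqp
  have e2 : F 1 = C := by simp [F]
  have e0 : ∀ i ∈ Finset.Iio q, i ≠ q := fun i hi => (Finset.mem_Iio.1 hi).ne
  rw [Iio_succ_fin hqp, Finset.sum_insert (by simp), Finset.sum_insert (by simp)]
  have s1 : ∑ j ∈ Finset.Iio q, (if q ≠ j ∧ (q = q ∨ j = q) then
      C • (regRep (1 : Equiv.Perm (Fin n) →* ℤˣ) (swap q p) * regRep 1 (swap j p)) else 0) =
      C • (regRep 1 (swap q p) * ∑ j ∈ Finset.Iio q, regRep 1 (swap j p)) := by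
    rw [Finset.mul_sum, Finset.smul_sum]
    refine Finset.sum_congr rfl fun j hj => ?_
    rw [if_pos ⟨(e0 j hj).symm, Or.inl rfl⟩]
  have s2 : ∑ i ∈ Finset.Iio q, ∑ j ∈ insert q (Finset.Iio q), (if i ≠ j ∧ (i = q ∨ j = q) then
      C • (regRep (1 : Equiv.Perm (Fin n) →* ℤˣ) (swap i p) * regRep 1 (swap j p)) else 0) =
      C • ((∑ j ∈ Finset.Iio q, regRep 1 (swap j p)) * regRep 1 (swap q p)) := by
    rw [Finset.sum_mul, Finset.smul_sum]
    refine Finset.sum_congr rfl fun i hi => ?_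
    rw [Finset.sum_insert (by simp), if_pos ⟨e0 i hi, Or.inr rfl⟩, Finset.sum_eq_zero, add_zero]
    intro j hj
    rw [if_neg]
    rintro ⟨_, h | h⟩
    · exact e0 i hi h
    · exact e0 j hj h
  rw [s1, s2, e2, map_one]
  have hS : ∑ i ∈ Finset.Iio q, regRep (1 : Equiv.Perm (Fin n) →* ℤˣ) (swap i p) = JM (regRep 1) p - regRep 1 (swap q p) := by
    rw [hJ]; abel
  have hss : regRep (1 : Equiv.Perm (Fin n) →* ℤˣ) (swap q p) * regRep 1 (swap q p) = 1 := by
    rw [← map_mul, swap_mul_self, map_one]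
  rw [hS, mul_sub, sub_mul, hss, hrel]
  simp only [ne_eq, not_true_eq_false, false_and, if_false, zero_add, ← smul_add]
  congr 1
  rw [mul_add]
  abel

lemma JM_trace {n : ℕ} (p q : Fin n) (hqp : q.val + 1 = p.val) (m : ℕ)
    {ι : Type*} [Fintype ι]
    (b : OrthonormalBasis ι ℝ (EuclideanSpace ℝ (Equiv.Perm (Fin n)))) (a : ι → ℝ)
    (ha : ∀ i, JM (regRep 1) p (b i) = a i • b i) :
    (p.val : ℝ) * ∑ i, a i ^ m * inner ℝ (b i) (regRep 1 (swap q p) (b i)) = ∑ i, a i ^ (m + 1) := by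
  set J := JM (regRep (1 : Equiv.Perm (Fin n) →* ℤˣ)) p with hJ
  have hqp' : q < p := by rw [Fin.lt_def]; omega
  have hpow : ∀ k i, (J ^ k) (b i) = a i ^ k • b i := by
    intro k i
    induction k with
    | zero => simp
    | succ k ih => rw [pow_succ', Module.End.mul_apply, ih, map_smul, ha, smul_smul, pow_succ]
  have h1 : ∀ i ∈ Finset.Iio p, LinearMap.trace ℝ _ (regRep 1 (swap i p) * J ^ m)
      = LinearMap.trace ℝ _ (regRep 1 (swap q p) * J ^ m) := by
    intro i hi
    rw [Finset.mem_Iio] at hi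
    have hc : Commute (regRep 1 (swap i q)) (J ^ m) :=
      Commute.pow_right (JM_comm_swap (regRep 1) hi hqp') m
    have e : regRep (1 : Equiv.Perm (Fin n) →* ℤˣ) (swap i p) =
        regRep 1 (swap i q) * (regRep 1 (swap q p) * regRep 1 (swap i q)) := by
      by_cases hiq : i = q
      · rw [hiq, swap_self]
        change _ = regRep 1 1 * (_ * regRep 1 1)
        rw [map_one, one_mul, mul_one]
      rw [← map_mul, ← map_mul, ← mul_assoc, swap_comm i q, swap_comm q p,
        Equiv.swap_mul_swap_mul_swap hqp'.ne' hi.ne']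
    have hss : regRep (1 : Equiv.Perm (Fin n) →* ℤˣ) (swap i q) * regRep 1 (swap i q) = 1 := by
      rw [← map_mul, swap_mul_self, map_one]
    rw [e, mul_assoc, LinearMap.trace_mul_comm, mul_assoc, mul_assoc, ← hc.eq, ← mul_assoc (regRep 1 (swap i q)), hss, one_mul]
  have h2 : LinearMap.trace ℝ _ (J ^ (m + 1)) = p.val * LinearMap.trace ℝ _ (regRep 1 (swap q p) * J ^ m) := by
    rw [pow_succ']
    conv_lhs => rw [hJ, JM, Finset.sum_mul, map_sum]
    rw [← JM, ← hJ, Finset.sum_congr rfl h1]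
    simp
  rw [LinearMap.trace_eq_sum_inner _ b, LinearMap.trace_eq_sum_inner _ b] at h2
  have h3 : ∀ i, inner ℝ (b i) (b i) = (1 : ℝ) := by
    intro i; rw [real_inner_self_eq_norm_sq, b.norm_eq_one]; norm_num
  simp only [hpow, Module.End.mul_apply, map_smul, inner_smul_right, h3, mul_one] at h2
  rw [h2]

end OpSec
section BoundSec
open Equiv Equiv.Perm

lemma JM_sign {n : ℕ} (p : Fin n) : JM (regRep (Equiv.Perm.sign : Equiv.Perm (Fin n) →* ℤˣ)) p
    = - JM (regRep 1) p := by
  rw [JM, JM, ← Finset.sum_neg_distrib]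
  refine Finset.sum_congr rfl fun i hi => ?_
  have hne : i ≠ p := (Finset.mem_Iio.1 hi).ne
  ext f x
  rw [regRep_apply, LinearMap.neg_apply, PiLp.neg_apply, regRep_apply, sign_swap hne]
  simp

lemma JM_count {n : ℕ} (p : Fin n) {ι : Type*} [Fintype ι]
    (b : OrthonormalBasis ι ℝ (EuclideanSpace ℝ (Equiv.Perm (Fin n)))) (z : ι → ℤ)
    (hz : ∀ i, JM (regRep 1) p (b i) = (z i : ℝ) • b i) (d : ℕ) (hd : n = p.val + 1 + d)
    (H : ℕ → ℝ) (hH : ∀ A, 0 ≤ H A) :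
    ∑ i, H (z i).natAbs ≤ ∑ j ∈ Finset.range (p.val + 1),
      2 * ((n : ℝ) ^ (2 * j + d) / j.factorial) * H (p.val - j) := by
  have hA : ∀ i, (z i).natAbs ≤ p.val := by
    intro i
    have h1 := JM_norm (regRep 1) (regRep_inner 1) p (b.orthonormal.ne_zero i) (hz i)
    have h2 : (((z i).natAbs : ℕ) : ℝ) = |(z i : ℝ)| := by
      rw [Nat.cast_natAbs, Int.cast_abs]
    rw [← h2] at h1
    exact_mod_cast h1
  have hcount : ∀ j ∈ Finset.range (p.val + 1),
      ((Finset.univ.filter fun i => p.val - (z i).natAbs = j).card : ℝ) ≤ 2 * ((n : ℝ) ^ (2 * j + d) / j.factorial) := by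
    intro j hj
    rw [Finset.mem_range] at hj
    have hr : p.val + 1 - j ≤ p.val + 1 := by omega
    have hcast : ((p.val + 1 - j : ℕ) : ℝ) - 2 = ((p.val - j : ℕ) : ℝ) - 1 := by
      rw [Nat.cast_sub (by omega), Nat.cast_sub (by omega)]; push_cast; ring
    have h1 := JM_mult 1 p (p.val + 1 - j) hr (Finset.univ.filter fun i => z i = ((p.val - j : ℕ) : ℤ)) b
      b.orthonormal (fun i => (z i : ℝ)) (fun i _ => hz i) (by
        intro i hi
        simp only [Finset.mem_filter, Finset.mem_univ, true_and] at hi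
        rw [hcast, hi, Int.cast_natCast]; linarith)
    have h2 := JM_mult (Equiv.Perm.sign) p (p.val + 1 - j) hr (Finset.univ.filter fun i => - z i = ((p.val - j : ℕ) : ℤ)) b
      b.orthonormal (fun i => -(z i : ℝ)) (fun i _ => by
        rw [JM_sign, LinearMap.neg_apply, hz, neg_smul]) (by
        intro i hi
        simp only [Finset.mem_filter, Finset.mem_univ, true_and] at hi
        rw [hcast, ← Int.cast_neg, hi, Int.cast_natCast]; linarith)
    have h3 : (Finset.univ.filter fun i => p.val - (z i).natAbs = j) ⊆
        (Finset.univ.filter fun i => z i = ((p.val - j : ℕ) : ℤ)) ∪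
        (Finset.univ.filter fun i => - z i = ((p.val - j : ℕ) : ℤ)) := by
      intro i hi
      simp only [Finset.mem_filter, Finset.mem_univ, true_and, Finset.mem_union] at hi ⊢
      have := hA i
      omega
    have h4 := (Finset.card_le_card h3).trans (Finset.card_union_le _ _)
    have h5 : (p.val + 1).choose (p.val + 1 - j) * n.descFactorial (n - (p.val + 1 - j)) ≤
        n.choose j * n ^ (j + d) := by
      have e1 : (p.val + 1).choose (p.val + 1 - j) = (p.val + 1).choose j := Nat.choose_symm (by omega)
      have e2 : n - (p.val + 1 - j) = j + d := by omega
      rw [e1, e2]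
      exact Nat.mul_le_mul (Nat.choose_le_choose j (by omega)) (Nat.descFactorial_le_pow n _)
    have h6 : (n.choose j : ℝ) ≤ (n : ℝ) ^ j / j.factorial := Nat.choose_le_pow_div j n
    have h7 : ((Finset.univ.filter fun i => p.val - (z i).natAbs = j).card : ℝ) ≤ 2 * ((n.choose j : ℝ) * (n : ℝ) ^ (j + d)) := by
      have : (Finset.univ.filter fun i => p.val - (z i).natAbs = j).card ≤ 2 * (n.choose j * n ^ (j + d)) := by
        omega
      exact_mod_cast this
    refine h7.trans ?_
    have h8 : (n.choose j : ℝ) * (n : ℝ) ^ (j + d) ≤ (n : ℝ) ^ j / j.factorial * (n : ℝ) ^ (j + d) :=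
      mul_le_mul_of_nonneg_right h6 (by positivity)
    have h9 : (n : ℝ) ^ j / j.factorial * (n : ℝ) ^ (j + d) = (n : ℝ) ^ (2 * j + d) / j.factorial := by
      rw [div_mul_eq_mul_div, ← pow_add]; congr 2; ring
    linarith
  rw [← Finset.sum_fiberwise_of_maps_to (s := Finset.univ) (t := Finset.range (p.val + 1))
    (g := fun i => p.val - (z i).natAbs) (by intro i _; rw [Finset.mem_range]; omega)]
  refine Finset.sum_le_sum fun j hj => ?_
  have h1 : ∑ i ∈ Finset.univ.filter (fun i => p.val - (z i).natAbs = j), H (z i).natAbs =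
      ∑ i ∈ Finset.univ.filter (fun i => p.val - (z i).natAbs = j), H (p.val - j) := by
    refine Finset.sum_congr rfl fun i hi => ?_
    simp only [Finset.mem_filter, Finset.mem_univ, true_and] at hi
    congr 1
    have := hA i
    omega
  rw [h1, Finset.sum_const, nsmul_eq_mul]
  exact mul_le_mul_of_nonneg_right (hcount j hj) (hH _)

lemma joint_basis {n : ℕ} (p q : Fin n) (hqp : q < p) :
    ∃ (N : ℕ) (b : OrthonormalBasis (Fin N) ℝ (EuclideanSpace ℝ (Equiv.Perm (Fin n)))) (z w : Fin N → ℤ),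
      (∀ i, JM (regRep 1) p (b i) = (z i : ℝ) • b i) ∧ (∀ i, JM (regRep 1) q (b i) = (w i : ℝ) • b i) := by
  have hp := JM_symm (regRep 1) (regRep_inner 1) p
  have hq := JM_symm (regRep 1) (regRep_inner 1) q
  have hint0 := LinearMap.IsSymmetric.directSum_isInternal_of_commute hp hq (JM_comm (regRep 1) hqp).symm
  have hor0 := LinearMap.IsSymmetric.orthogonalFamily_eigenspace_inf_eigenspace hp hq
  have hint := DirectSum.isInternal_ne_bot_iff.2 hint0
  have hor := hor0.comp (Subtype.val_injective (p := fun i : ℝ × ℝ =>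
    (Module.End.eigenspace (JM (regRep 1) p) i.2 ⊓ Module.End.eigenspace (JM (regRep 1) q) i.1) ≠ ⊥))
  haveI : Fintype {i : ℝ × ℝ // (Module.End.eigenspace (JM (regRep 1) p) i.2 ⊓
      Module.End.eigenspace (JM (regRep 1) q) i.1) ≠ ⊥} :=
    hint0.submodule_iSupIndep.fintypeNeBotOfFiniteDimensional
  let b := hint.subordinateOrthonormalBasis rfl hor
  let x : Fin _ → ℝ × ℝ := fun i => (hint.subordinateOrthonormalBasisIndex rfl i hor).1
  have hb : ∀ i, JM (regRep 1) p (b i) = (x i).2 • b i ∧ JM (regRep 1) q (b i) = (x i).1 • b i := by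
    intro i
    have := hint.subordinateOrthonormalBasis_subordinate rfl i hor
    rw [Submodule.mem_inf, Module.End.mem_eigenspace_iff, Module.End.mem_eigenspace_iff] at this
    exact this
  have h1 : ∀ i, ∃ z : ℤ, (x i).2 = z := fun i =>
    JM_int (regRep 1) (regRep_inner 1) p.val p rfl (b i) (b.orthonormal.ne_zero i) _ (hb i).1
  have h2 : ∀ i, ∃ z : ℤ, (x i).1 = z := fun i =>
    JM_int (regRep 1) (regRep_inner 1) q.val q rfl (b i) (b.orthonormal.ne_zero i) _ (hb i).2
  choose z hz using h1
  choose w hw using h2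
  exact ⟨_, b, z, w, fun i => by rw [(hb i).1, hz], fun i => by rw [(hb i).2, hw]⟩

lemma int_case (z w : ℤ) (hne : z ≠ w) (h1 : ¬ (0 < z ∧ z = w + 1)) (h2 : ¬ (z < 0 ∧ z = w - 1)) :
    |z + w| ≤ 2 * |z| - 2 ∨ |z + w| ≤ 2 * |w| - 1 := by
  rcases abs_cases (z + w) with h | h <;> rcases abs_cases z with h' | h' <;>
    rcases abs_cases w with h'' | h'' <;> omega

lemma theta_bound (z w : ℤ) (m : ℝ) (hm : 0 < m) (k' : ℕ) (hk' : 1 ≤ k') (t : ℝ)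
    (hti : ((z : ℝ) - w) * t = 1) (hzw : z ≠ w) (hc1 : ¬ (0 < z ∧ z = w + 1)) (hc2 : ¬ (z < 0 ∧ z = w - 1))
    (hθ1 : |(z : ℝ) / m| ≤ 1)
    (hlast : 0 ≤ |(z : ℝ) / m| ^ (4 * k' - 1) - ((z : ℝ) / m) ^ (4 * k' - 1) * t) :
    2 * ((z : ℝ) / m) ^ (4 * k') ≤ 4 * (|(z : ℝ) / m| ^ (4 * k' - 1) - ((z : ℝ) / m) ^ (4 * k' - 1) * t) := by
  set θ : ℝ := (z : ℝ) / m with hθ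
  have e1 : θ ^ (4 * k') = |θ| ^ (4 * k') := by
    rw [show 4 * k' = 2 * (2 * k') by ring, pow_mul, pow_mul |θ|, sq_abs]
  have e2 : |θ| ^ (4 * k') ≤ |θ| ^ (4 * k' - 1) :=
    pow_le_pow_of_le_one (abs_nonneg _) hθ1 (by omega)
  have hodd : Odd (4 * k' - 1) := ⟨2 * k' - 1, by omega⟩
  rcases lt_trichotomy z 0 with hz0 | hz0 | hz0
  · have hzr : (z : ℝ) < 0 := by exact_mod_cast hz0
    have hθneg : θ < 0 := div_neg_of_neg_of_pos hzr (by linarith)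
    have e3 : θ ^ (4 * k' - 1) = - |θ| ^ (4 * k' - 1) := by
      rw [abs_of_neg hθneg, hodd.neg_pow, neg_neg]
    have ht2 : -t ≤ 1 / 2 := by
      rcases lt_or_gt_of_ne hzw with h | h
      · have h' : (2 : ℝ) ≤ w - z := by exact_mod_cast (by omega : 2 ≤ w - z)
        by_contra! hh
        nlinarith
      · have h' : (0 : ℝ) < z - w := by exact_mod_cast (by omega : 0 < z - w)
        by_contra! hh
        nlinarith
    rw [e1, e3]
    have : 0 ≤ |θ| ^ (4 * k' - 1) := by positivity
    nlinarith
  · have : θ = 0 := by rw [hθ, hz0]; simp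
    rw [this, zero_pow (by omega), mul_zero]
    rw [this] at hlast
    linarith
  · have hzr : 0 < (z : ℝ) := by exact_mod_cast hz0
    have hθpos : 0 < θ := div_pos hzr (by linarith)
    have e3 : θ ^ (4 * k' - 1) = |θ| ^ (4 * k' - 1) := by
      rw [abs_of_pos hθpos]
    have ht2 : t ≤ 1 / 2 := by
      rcases lt_or_gt_of_ne hzw with h | h
      · have h' : (0 : ℝ) < w - z := by exact_mod_cast (by omega : 0 < w - z)
        by_contra! hh
        nlinarith
      · have h' : (2 : ℝ) ≤ z - w := by exact_mod_cast (by omega : 2 ≤ z - w)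
        by_contra! hh
        nlinarith
    rw [e1, e3]
    have : 0 ≤ |θ| ^ (4 * k' - 1) := by positivity
    nlinarith

set_option maxHeartbeats 1000000 in
/-- pointwise estimate for one joint eigenvector -/
lemma pointwise {n : ℕ} (hn : 3 ≤ n) (p q : Fin n) (hp : p.val = n - 1) (hqp : q.val + 1 = p.val)
    (k k' : ℕ) (hk' : 1 ≤ k') (v : EuclideanSpace ℝ (Equiv.Perm (Fin n))) (hv : ‖v‖ = 1) (z w : ℤ)
    (hz : JM (regRep 1) p v = (z : ℝ) • v) (hw : JM (regRep 1) q v = (w : ℝ) • v) :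
    ‖(opT (Pmeas n) ^ k - opT (P'meas n) ^ k') v‖ ^ 2 ≤
      ((max 0 ((2 * |(z : ℝ)| - 1) / (2 * n - 3))) ^ k - (|(z : ℝ)| / (n - 1)) ^ (2 * k')) ^ 2
      + 2 * (max 0 ((2 * |(z : ℝ)| - 2) / (2 * n - 3))) ^ (2 * k)
      + 2 * (max 0 ((2 * |(w : ℝ)| - 1) / (2 * n - 3))) ^ (2 * k)
      + 4 * ((|(z : ℝ)| / (n - 1)) ^ (4 * k' - 1) - ((z : ℝ) / (n - 1)) ^ (4 * k' - 1) *
          inner ℝ v (regRep 1 (swap q p) v)) := by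
  have hn' : (3 : ℝ) ≤ n := by exact_mod_cast hn
  have hpn : (p.val : ℝ) = n - 1 := by rw [hp, Nat.cast_sub (by omega)]; simp
  have hv0 : v ≠ 0 := by intro h; rw [h] at hv; simp at hv
  have hρ := regRep_inner (1 : Equiv.Perm (Fin n) →* ℤˣ)
  set τ := regRep (1 : Equiv.Perm (Fin n) →* ℤˣ) (swap q p) with hτ
  set t : ℝ := inner ℝ v (τ v) with ht
  have hti : ((z : ℝ) - w) * t = 1 := by
    have := JM_inner (regRep 1) hρ hqp hz hw
    rw [real_inner_self_eq_norm_sq, hv] at this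
    simpa using this
  have hτn : ∀ u, ‖τ u‖ = ‖u‖ := by
    intro u
    have := hρ (swap q p) u u
    rw [real_inner_self_eq_norm_sq, real_inner_self_eq_norm_sq] at this
    exact (pow_left_inj₀ (norm_nonneg _) (norm_nonneg _) two_ne_zero).1 this
  have hτkn : ∀ k, ‖(τ ^ k) v‖ = 1 := by
    intro k
    induction k with
    | zero => simpa using hv
    | succ k ih => rw [pow_succ', Module.End.mul_apply, hτn, ih]
  have htabs : |t| ≤ 1 := by
    have := abs_real_inner_le_norm v (τ v)
    rw [hτn, hv] at this
    simpa using this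
  set x : ℝ := ((z : ℝ) + w) / (2 * n - 3) with hx
  set θ : ℝ := (z : ℝ) / (n - 1) with hθ
  have hC : Commute τ (opT (Pmeas n)) := by
    rw [opT_P hn p q hp hqp]
    refine Commute.smul_right ?_ _
    refine Commute.mul_right (Commute.refl _) ?_
    change τ * _ = _ * τ
    rw [mul_add, add_mul, JM_rel (regRep 1) hqp, JM_rel' (regRep 1) hqp]
    abel
  have hP1 : opT (Pmeas n) v = x • τ v := by
    rw [opT_P hn p q hp hqp, LinearMap.smul_apply, Module.End.mul_apply, LinearMap.add_apply, hz, hw,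
      ← add_smul, map_smul, smul_smul]
    congr 1
    rw [hx]; ring
  have hPk : ∀ k, (opT (Pmeas n) ^ k) v = x ^ k • (τ ^ k) v := by
    intro k
    induction k with
    | zero => simp
    | succ k ih =>
      have h1 : (opT (Pmeas n) ^ k) (τ v) = τ ((opT (Pmeas n) ^ k) v) := by
        rw [← Module.End.mul_apply, ← Module.End.mul_apply, (hC.pow_right k).eq]
      rw [pow_succ, Module.End.mul_apply, hP1, map_smul, h1, ih, map_smul, smul_smul, pow_succ' τ,
        Module.End.mul_apply, pow_succ']
  have hP'1 : opT (P'meas n) v = θ ^ 2 • v := by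
    rw [opT_P' hn p hp, LinearMap.smul_apply, Module.End.mul_apply, hz, map_smul, hz, smul_smul, smul_smul]
    congr 1
    rw [hθ, div_pow]; ring
  have hP'k : ∀ k, (opT (P'meas n) ^ k) v = θ ^ (2 * k) • v := by
    intro k
    induction k with
    | zero => simp
    | succ k ih =>
      rw [pow_succ, Module.End.mul_apply, hP'1, map_smul, ih, smul_smul]
      congr 1; ring
  have hθabs : |(z : ℝ)| / (n - 1) = |θ| := by
    rw [hθ, abs_div, abs_of_pos (show (0 : ℝ) < n - 1 by linarith)]
  have hθ1 : |θ| ≤ 1 := by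
    rw [← hθabs, div_le_one (by linarith), ← hpn]
    exact JM_norm (regRep 1) hρ p hv0 hz
  have hθe : |θ| ^ (2 * k') = θ ^ (2 * k') := by
    rw [pow_mul, sq_abs, ← pow_mul]
  have hlast : 0 ≤ |θ| ^ (4 * k' - 1) - θ ^ (4 * k' - 1) * t := by
    have : θ ^ (4 * k' - 1) * t ≤ |θ| ^ (4 * k' - 1) := by
      refine (le_abs_self _).trans ?_
      rw [abs_mul, abs_pow]
      exact mul_le_of_le_one_right (by positivity) htabs
    linarith
  have hd : (0 : ℝ) < 2 * n - 3 := by linarith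
  rw [hθabs, LinearMap.sub_apply, hPk, hP'k]
  set M1 : ℝ := max 0 ((2 * |(z : ℝ)| - 2) / (2 * n - 3)) with hM1
  set M2 : ℝ := max 0 ((2 * |(w : ℝ)| - 1) / (2 * n - 3)) with hM2
  have hM1' : 0 ≤ M1 := le_max_left _ _
  have hM2' : 0 ≤ M2 := le_max_left _ _
  have hM1p : 0 ≤ M1 ^ (2 * k) := by positivity
  have hM2p : 0 ≤ M2 ^ (2 * k) := by positivity
  -- eigenvector of τ in the extreme cases
  have hτfix : ∀ ε : ℝ, ε * ε = 1 → t = ε → τ v = ε • v := by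
    intro ε hε hte
    have : ‖τ v - ε • v‖ ^ 2 = 0 := by
      rw [norm_sub_sq_real, hτn, norm_smul, hv, inner_smul_right, real_inner_comm, ← ht, hte]
      rw [Real.norm_eq_abs, mul_one, sq_abs]
      nlinarith
    have := pow_eq_zero_iff (two_ne_zero) |>.1 this
    exact sub_eq_zero.1 (norm_eq_zero.1 this)
  have hgood : ∀ ε : ℝ, ε * ε = 1 → t = ε → ε * x = max 0 ((2 * |(z : ℝ)| - 1) / (2 * n - 3)) →
      ‖x ^ k • (τ ^ k) v - θ ^ (2 * k') • v‖ ^ 2 =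
      ((max 0 ((2 * |(z : ℝ)| - 1) / (2 * n - 3))) ^ k - |θ| ^ (2 * k')) ^ 2 := by
    intro ε hε hte hxe
    have h1 : ∀ k, (τ ^ k) v = ε ^ k • v := by
      intro k
      induction k with
      | zero => simp
      | succ k ih => rw [pow_succ, Module.End.mul_apply, hτfix ε hε hte, map_smul, ih, smul_smul, pow_succ']
    rw [h1, smul_smul, ← mul_pow, mul_comm x, hxe, hθe, ← sub_smul, norm_smul, hv, mul_one, Real.norm_eq_abs, sq_abs]
  by_cases hc1 : 0 < z ∧ z = w + 1
  · have hzr : (z : ℝ) = w + 1 := by exact_mod_cast hc1.2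
    have hz1 : (1 : ℝ) ≤ z := by exact_mod_cast hc1.1
    have := hgood 1 (by norm_num) (by rw [hzr] at hti; linarith) (by
      rw [abs_of_pos (by linarith), max_eq_right (by apply div_nonneg <;> linarith), hx, hzr]
      ring)
    rw [this]
    linarith
  by_cases hc2 : z < 0 ∧ z = w - 1
  · have hzr : (z : ℝ) = w - 1 := by exact_mod_cast hc2.2
    have hz1 : (z : ℝ) ≤ -1 := by exact_mod_cast (by omega : z ≤ -1)
    have := hgood (-1) (by norm_num) (by rw [hzr] at hti; linarith) (by
      rw [abs_of_neg (by linarith), max_eq_right (by apply div_nonneg <;> linarith), hx, hzr]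
      ring)
    rw [this]
    linarith
  have hzw : z ≠ w := by
    rintro rfl
    simp at hti
  have hxb : x ^ (2 * k) ≤ M1 ^ (2 * k) + M2 ^ (2 * k) := by
    have e : x ^ (2 * k) = |x| ^ (2 * k) := by rw [pow_mul |x|, sq_abs, ← pow_mul]
    have e2 : |x| = |(z : ℝ) + w| / (2 * n - 3) := by rw [hx, abs_div, abs_of_pos hd]
    rcases int_case z w hzw hc1 hc2 with h | h
    · have h' : |(z : ℝ) + w| ≤ 2 * |(z : ℝ)| - 2 := by exact_mod_cast h
      have : |x| ≤ M1 := by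
        rw [e2]; refine le_trans ?_ (le_max_right _ _)
        gcongr
      have := pow_le_pow_left₀ (abs_nonneg x) this (2 * k)
      rw [e]; linarith
    · have h' : |(z : ℝ) + w| ≤ 2 * |(w : ℝ)| - 1 := by exact_mod_cast h
      have : |x| ≤ M2 := by
        rw [e2]; refine le_trans ?_ (le_max_right _ _)
        gcongr
      have := pow_le_pow_left₀ (abs_nonneg x) this (2 * k)
      rw [e]; linarith
  have hsplit : ‖x ^ k • (τ ^ k) v - θ ^ (2 * k') • v‖ ^ 2 ≤ 2 * x ^ (2 * k) + 2 * θ ^ (4 * k') := by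
    have h1 := norm_sub_le (x ^ k • (τ ^ k) v) (θ ^ (2 * k') • v)
    rw [norm_smul, norm_smul, hτkn, hv, mul_one, mul_one] at h1
    have h2 : ‖x ^ k‖ ^ 2 = x ^ (2 * k) := by rw [Real.norm_eq_abs, sq_abs, ← pow_mul, mul_comm]
    have h3 : ‖θ ^ (2 * k')‖ ^ 2 = θ ^ (4 * k') := by
      rw [Real.norm_eq_abs, sq_abs, ← pow_mul]; congr 1; ring
    rw [← h2, ← h3]
    have h4 := pow_le_pow_left₀ (norm_nonneg _) h1 2
    nlinarith [sq_nonneg (‖x ^ k‖ - ‖θ ^ (2 * k')‖)]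
  have hθb : 2 * θ ^ (4 * k') ≤ 4 * (|θ| ^ (4 * k' - 1) - θ ^ (4 * k' - 1) * t) :=
    theta_bound z w (n - 1) (by linarith) k' hk' t hti hzw hc1 hc2 hθ1 hlast
  have := sq_nonneg ((max 0 ((2 * |(z : ℝ)| - 1) / (2 * n - 3))) ^ k - |θ| ^ (2 * k'))
  linarith

end BoundSec

section FiniteSec
open Equiv Equiv.Perm

noncomputable def uu (n : ℕ) (t : ℝ) : ℝ := max 0 (1 - t / ((n : ℝ) - 3 / 2))
noncomputable def ww (n : ℕ) (t : ℝ) : ℝ := max 0 (1 - t / ((n : ℝ) - 1))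

lemma finite_bound {n : ℕ} (hn : 3 ≤ n) (k k' : ℕ) (hk' : 1 ≤ k') :
    (n.factorial : ℝ) * ∑ σ : alternatingGroup (Fin n), (convPow (Pmeas n) k σ - convPow (P'meas n) k' σ) ^ 2 ≤
    (∑ j ∈ Finset.range n, 2 * ((n : ℝ) ^ (2 * j) / j.factorial) *
      ((uu n j ^ k - ww n j ^ (2 * k')) ^ 2 + 2 * uu n (j + 1 / 2) ^ (2 * k)
        + 4 * (ww n j ^ (4 * k' - 1) * (1 - ww n j)))) +
    ∑ j ∈ Finset.range (n - 1), 2 * ((n : ℝ) ^ (2 * j + 1) / j.factorial) * (2 * uu n (j + 1) ^ (2 * k)) := by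
  have hn' : (3 : ℝ) ≤ n := by exact_mod_cast hn
  let p : Fin n := ⟨n - 1, by omega⟩
  let q : Fin n := ⟨n - 2, by omega⟩
  have hp : p.val = n - 1 := rfl
  have hqp : q.val + 1 = p.val := by simp only [p, q]; omega
  have hqp' : q < p := by rw [Fin.lt_def]; omega
  have hpn : (p.val : ℝ) = n - 1 := by rw [hp, Nat.cast_sub (by omega)]; simp
  obtain ⟨N, b, z, w, hz, hw⟩ := joint_basis p q hqp'
  have hzn : ∀ i, |(z i : ℝ)| ≤ n - 1 := by
    intro i
    rw [← hpn]
    exact JM_norm (regRep 1) (regRep_inner 1) p (b.orthonormal.ne_zero i) (hz i)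
  have hab : ∀ y : ℤ, |(y : ℝ)| = (y.natAbs : ℝ) := by
    intro y; rw [Nat.cast_natAbs, Int.cast_abs]
  rw [← opT_norm (fun σ => convPow (Pmeas n) k σ - convPow (P'meas n) k' σ) b, opT_sub, opT_convPow, opT_convPow]
  let t : Fin N → ℝ := fun i => inner ℝ (b i) (regRep 1 (swap q p) (b i))
  let H1 : ℕ → ℝ := fun A => ((max 0 ((2 * (A : ℝ) - 1) / (2 * n - 3))) ^ k - ((A : ℝ) / (n - 1)) ^ (2 * k')) ^ 2
      + 2 * (max 0 ((2 * (A : ℝ) - 2) / (2 * n - 3))) ^ (2 * k)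
      + 4 * (((A : ℝ) / (n - 1)) ^ (4 * k' - 1) * max 0 (1 - (A : ℝ) / (n - 1)))
  let H2 : ℕ → ℝ := fun A => 2 * (max 0 ((2 * (A : ℝ) - 1) / (2 * n - 3))) ^ (2 * k)
  have hm : (0 : ℝ) < n - 1 := by linarith
  have hH1 : ∀ A, 0 ≤ H1 A := by
    intro A
    have h1 : 0 ≤ max 0 ((2 * (A : ℝ) - 2) / (2 * n - 3)) := le_max_left _ _
    have h2 : 0 ≤ max 0 (1 - (A : ℝ) / (n - 1)) := le_max_left _ _
    have h3 : 0 ≤ (A : ℝ) / (n - 1) := by positivity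
    simp only [H1]
    positivity
  have hH2 : ∀ A, 0 ≤ H2 A := by
    intro A
    have h1 : 0 ≤ max 0 ((2 * (A : ℝ) - 1) / (2 * n - 3)) := le_max_left _ _
    simp only [H2]
    positivity
  have htr := JM_trace p q hqp (4 * k' - 1) b (fun i => (z i : ℝ)) hz
  have hE : 4 * k' - 1 + 1 = 4 * k' := by omega
  rw [hE, hpn] at htr
  have htr2 : ∑ i, ((z i : ℝ) / (n - 1)) ^ (4 * k' - 1) * t i = ∑ i, (|(z i : ℝ)| / (n - 1)) ^ (4 * k') := by
    have e1 : ∀ i, ((z i : ℝ) / (n - 1)) ^ (4 * k' - 1) * t i =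
        ((n - 1 : ℝ) ^ (4 * k'))⁻¹ * ((n - 1 : ℝ) * ((z i : ℝ) ^ (4 * k' - 1) * t i)) := by
      intro i
      have : (n - 1 : ℝ) ^ (4 * k') = (n - 1 : ℝ) ^ (4 * k' - 1) * (n - 1) := by rw [← pow_succ, hE]
      rw [this, div_pow]
      field_simp
    have e2 : ∀ i, (|(z i : ℝ)| / (n - 1)) ^ (4 * k') = ((n - 1 : ℝ) ^ (4 * k'))⁻¹ * (z i : ℝ) ^ (4 * k') := by
      intro i
      rw [div_pow, show 4 * k' = 2 * (2 * k') by ring, pow_mul |(z i : ℝ)|, sq_abs, ← pow_mul]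
      field_simp
    simp only [e1, e2]
    rw [← Finset.mul_sum, ← Finset.mul_sum, ← Finset.mul_sum, htr]
  have step1 : ∑ i, ‖(opT (Pmeas n) ^ k - opT (P'meas n) ^ k') (b i)‖ ^ 2 ≤
      ∑ i, H1 (z i).natAbs + ∑ i, H2 (w i).natAbs := by
    have h1 := Finset.sum_le_sum (s := Finset.univ) fun i _ =>
      pointwise hn p q hp hqp k k' hk' (b i) (b.orthonormal.1 i) (z i) (w i) (hz i) (hw i)
    refine h1.trans (le_of_eq ?_)
    have h2 : ∀ i, H1 (z i).natAbs = ((max 0 ((2 * |(z i : ℝ)| - 1) / (2 * n - 3))) ^ k - (|(z i : ℝ)| / (n - 1)) ^ (2 * k')) ^ 2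
      + 2 * (max 0 ((2 * |(z i : ℝ)| - 2) / (2 * n - 3))) ^ (2 * k)
      + 4 * ((|(z i : ℝ)| / (n - 1)) ^ (4 * k' - 1) - (|(z i : ℝ)| / (n - 1)) ^ (4 * k')) := by
      intro i
      have h3 : 0 ≤ 1 - |(z i : ℝ)| / (n - 1) := by
        rw [sub_nonneg, div_le_one hm]; exact hzn i
      simp only [H1]
      rw [← hab, max_eq_right h3, ← hE, pow_succ]
      simp only [Nat.add_sub_cancel]
      ring
    have h4 : ∀ i, H2 (w i).natAbs = 2 * (max 0 ((2 * |(w i : ℝ)| - 1) / (2 * n - 3))) ^ (2 * k) := by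
      intro i
      simp only [H2]
      rw [← hab]
    simp only [h2, h4]
    simp only [Finset.sum_add_distrib, ← Finset.mul_sum, Finset.sum_sub_distrib]
    rw [← htr2]
    ring
  have c1 := JM_count p b z hz 0 (by omega) H1 hH1
  have c2 := JM_count q b w hw 1 (by omega) H2 hH2
  refine step1.trans ((add_le_add c1 c2).trans (le_of_eq ?_))
  have r1 : p.val + 1 = n := by omega
  have r2 : q.val + 1 = n - 1 := by omega
  rw [r1, r2]
  have hd : (2 * n - 3 : ℝ) ≠ 0 := by linarith
  have hd' : (n - 3 / 2 : ℝ) ≠ 0 := by linarith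
  congr 1
  · refine Finset.sum_congr rfl fun j hj => ?_
    rw [Finset.mem_range] at hj
    have hc : ((p.val - j : ℕ) : ℝ) = n - 1 - j := by
      rw [Nat.cast_sub (by omega), hpn]
    have hjr : (j : ℝ) ≤ n - 1 := by
      rw [← hpn]; exact_mod_cast (by omega : j ≤ p.val)
    have e1 : max 0 ((2 * (n - 1 - j : ℝ) - 1) / (2 * n - 3)) = uu n j := by
      rw [uu]; congr 1
      field_simp; ring
    have e2 : max 0 ((2 * (n - 1 - j : ℝ) - 2) / (2 * n - 3)) = uu n (j + 1 / 2) := by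
      rw [uu]; congr 1
      field_simp; ring
    have e3 : (n - 1 - j : ℝ) / (n - 1) = ww n j := by
      rw [ww, max_eq_right]
      · field_simp
      · rw [sub_nonneg, div_le_one hm]; exact hjr
    have e4 : max 0 (1 - ww n j) = 1 - ww n j := by
      rw [max_eq_right]
      rw [← e3, sub_nonneg, div_le_one hm]
      have : (0 : ℝ) ≤ j := by positivity
      linarith
    simp only [H1, hc, e1, e2, e3, e4, add_zero]
  · refine Finset.sum_congr rfl fun j hj => ?_
    rw [Finset.mem_range] at hj
    have hq : q.val = n - 2 := rfl
    have hc : ((q.val - j : ℕ) : ℝ) = n - 2 - j := by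
      rw [Nat.cast_sub (by omega), hq, Nat.cast_sub (by omega)]; simp
    have e1 : max 0 ((2 * (n - 2 - j : ℝ) - 1) / (2 * n - 3)) = uu n (j + 1) := by
      rw [uu]; congr 1
      field_simp; ring
    simp only [H2, hc, e1]

end FiniteSec

section AsympSec

lemma pow_exp_le (m t L : ℝ) (hm : 0 < m) (ht : 0 ≤ t) (k : ℕ) (hk : m * L ≤ k) :
    (max 0 (1 - t / m)) ^ k ≤ Real.exp (-(t * L)) := by
  have h1 : max 0 (1 - t / m) ≤ Real.exp (-(t / m)) := by
    refine max_le (Real.exp_pos _).le ?_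
    have := Real.add_one_le_exp (-(t / m))
    linarith
  refine (pow_le_pow_left₀ (le_max_left _ _) h1 k).trans ?_
  rw [← Real.exp_nat_mul]
  refine Real.exp_le_exp.2 ?_
  have h2 : t * L = t / m * (m * L) := by field_simp
  have h3 : t / m * (m * L) ≤ t / m * k := mul_le_mul_of_nonneg_left hk (by positivity)
  rw [h2]; linarith

lemma le_pow_exp (m t L : ℝ) (ht : 0 ≤ t) (hmt : t < m) (k : ℕ) (hk : (k : ℝ) ≤ m * L + 2) :
    Real.exp (-(t * L)) * Real.exp (-(t * ((t * L + 2) / (m - t)))) ≤ (max 0 (1 - t / m)) ^ k := by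
  have hm : 0 < m := by linarith
  have hmt' : 0 < m - t := by linarith
  have h1 : Real.exp (-(t / (m - t))) ≤ max 0 (1 - t / m) := by
    refine le_trans ?_ (le_max_right _ _)
    have h := Real.add_one_le_exp (t / (m - t))
    have e : t / (m - t) + 1 = m / (m - t) := by field_simp; ring
    have e2 : 1 - t / m = (m / (m - t))⁻¹ := by field_simp
    rw [Real.exp_neg, e2]
    rw [e] at h
    exact inv_anti₀ (by positivity) h
  refine le_trans ?_ (pow_le_pow_left₀ (Real.exp_pos _).le h1 k)
  rw [← Real.exp_nat_mul, ← Real.exp_add]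
  refine Real.exp_le_exp.2 ?_
  have h3 : t / (m - t) * k ≤ t / (m - t) * (m * L + 2) := mul_le_mul_of_nonneg_left hk (by positivity)
  have e3 : t / (m - t) * (m * L + 2) = t * L + t * ((t * L + 2) / (m - t)) := by field_simp; ring
  linarith

lemma npow_exp (n : ℕ) (hn : 0 < n) (c : ℝ) (a : ℕ) :
    (n : ℝ) ^ a * Real.exp (-(a * (Real.log n + c))) = Real.exp (-(a * c)) := by
  have h0 : (0 : ℝ) < n := by exact_mod_cast hn
  have : (n : ℝ) ^ a = Real.exp (a * Real.log n) := by rw [Real.exp_nat_mul, Real.exp_log h0]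
  rw [this, ← Real.exp_add]; congr 1; ring

lemma log_div_tendsto (c a t : ℝ) :
    Tendsto (fun n : ℕ => t * ((t * (Real.log n + c) + 2) / ((n : ℝ) - a - t))) atTop (nhds 0) := by
  have h1 : Tendsto (fun x : ℝ => Real.log x / x) atTop (nhds 0) := by
    simpa using Real.tendsto_pow_log_div_mul_add_atTop 1 0 1 one_ne_zero
  have h2 : Tendsto (fun n : ℕ => Real.log n / (n : ℝ)) atTop (nhds 0) := h1.comp tendsto_natCast_atTop_atTop
  have h3 : Tendsto (fun n : ℕ => (1 : ℝ) / (n : ℝ)) atTop (nhds 0) := tendsto_one_div_atTop_nhds_zero_nat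
  have h4 : Tendsto (fun n : ℕ => t * ((t * (Real.log n / (n : ℝ)) + (t * c + 2) * (1 / (n : ℝ))) /
      (1 - (a + t) * (1 / (n : ℝ))))) atTop (nhds (t * ((t * 0 + (t * c + 2) * 0) / (1 - (a + t) * 0)))) := by
    refine Tendsto.const_mul _ (Tendsto.div ?_ ?_ (by norm_num))
    · exact (h2.const_mul t).add (h3.const_mul _)
    · exact tendsto_const_nhds.sub (h3.const_mul _)
  simp only [mul_zero, add_zero, sub_zero, zero_div] at h4
  refine h4.congr' ?_
  filter_upwards [eventually_gt_atTop 0] with n hn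
  have h0 : (n : ℝ) ≠ 0 := by exact_mod_cast hn.ne'
  congr 1
  have e1 : t * (Real.log n / (n : ℝ)) + (t * c + 2) * (1 / (n : ℝ)) = (t * (Real.log n + c) + 2) / n := by
    field_simp; ring
  have e2 : 1 - (a + t) * (1 / (n : ℝ)) = ((n : ℝ) - a - t) / n := by field_simp; ring
  rw [e1, e2, div_div_div_cancel_right₀ h0]

lemma lim_pow (c a : ℝ) (j : ℕ) (K : ℕ → ℕ)
    (hK : ∀ᶠ n : ℕ in atTop, ((n : ℝ) - a) * (Real.log n + c) ≤ K n ∧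
      (K n : ℝ) ≤ ((n : ℝ) - a) * (Real.log n + c) + 2) :
    Tendsto (fun n : ℕ => (n : ℝ) ^ j * (max 0 (1 - (j : ℝ) / ((n : ℝ) - a))) ^ K n) atTop
      (nhds (Real.exp (-(j * c)))) := by
  have hl : Tendsto (fun n : ℕ => Real.exp (-(j * c)) *
      Real.exp (-((j : ℝ) * (((j : ℝ) * (Real.log n + c) + 2) / ((n : ℝ) - a - j))))) atTop
      (nhds (Real.exp (-(j * c)))) := by
    have := ((Real.continuous_exp.tendsto _).comp (log_div_tendsto c a j).neg).const_mul (Real.exp (-(j * c)))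
    simpa using this
  have hev : ∀ᶠ n : ℕ in atTop, (j : ℝ) + a + 1 < n ∧ a + 1 < n :=
    (tendsto_natCast_atTop_atTop.eventually_gt_atTop _).and (tendsto_natCast_atTop_atTop.eventually_gt_atTop _)
  refine tendsto_of_tendsto_of_tendsto_of_le_of_le' hl tendsto_const_nhds ?_ ?_
  · filter_upwards [hK, hev, eventually_gt_atTop 0] with n hn h1 h0
    have := le_pow_exp ((n : ℝ) - a) j (Real.log n + c) (by positivity) (by linarith) (K n) hn.2
    have h2 := mul_le_mul_of_nonneg_left this (show (0 : ℝ) ≤ (n : ℝ) ^ j by positivity)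
    rw [← mul_assoc, npow_exp n h0 c j] at h2
    exact h2
  · filter_upwards [hK, hev, eventually_gt_atTop 0] with n hn h1 h0
    have := pow_exp_le ((n : ℝ) - a) j (Real.log n + c) (by linarith) (by positivity) (K n) hn.1
    have h2 := mul_le_mul_of_nonneg_left this (show (0 : ℝ) ≤ (n : ℝ) ^ j by positivity)
    rw [npow_exp n h0 c j] at h2
    exact h2

lemma sum_dom (F : ℕ → ℕ → ℝ) (bd : ℕ → ℝ) (hs : Summable bd)
    (hb : ∀ᶠ n : ℕ in atTop, ∀ j < n, |F n j| ≤ bd j) (hb0 : ∀ j, 0 ≤ bd j)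
    (hl : ∀ j, Tendsto (fun n => F n j) atTop (nhds 0)) :
    Tendsto (fun n => ∑ j ∈ Finset.range n, F n j) atTop (nhds 0) := by
  have h := tendsto_tsum_of_dominated_convergence (𝓕 := atTop) (f := fun n j => if j < n then F n j else 0)
    (g := fun _ => (0 : ℝ)) hs (by
      intro j
      refine (hl j).congr' ?_
      filter_upwards [eventually_gt_atTop j] with n hn
      simp [hn]) (by
      filter_upwards [hb] with n hn j
      by_cases h : j < n
      · simpa [h] using hn j h
      · simpa [h] using hb0 j)
  rw [tsum_zero] at h
  refine h.congr fun n => ?_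
  rw [tsum_eq_sum (s := Finset.range n)]
  · refine Finset.sum_congr rfl fun j hj => ?_
    simp [Finset.mem_range.1 hj]
  · intro j hj
    rw [Finset.mem_range] at hj
    simp [hj]

end AsympSec

section FinalSec

lemma term_b (n : ℕ) (hn : 3 ≤ n) (c : ℝ) (k j : ℕ) (hk : ((n : ℝ) - 3 / 2) * (Real.log n + c) ≤ k) :
    (n : ℝ) ^ (2 * j) * uu n (j + 1 / 2) ^ (2 * k) ≤ Real.exp (-c) * Real.exp (-(2 * c)) ^ j * (1 / n) := by
  have hn' : (3 : ℝ) ≤ n := by exact_mod_cast hn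
  have h1 := pow_exp_le ((n : ℝ) - 3 / 2) ((j : ℝ) + 1 / 2) (2 * (Real.log n + c)) (by linarith) (by positivity)
    (2 * k) (by push_cast; linarith)
  have h2 := npow_exp n (by omega) c (2 * j + 1)
  have h3 := mul_le_mul_of_nonneg_left h1 (show (0 : ℝ) ≤ (n : ℝ) ^ (2 * j + 1) by positivity)
  rw [show -(((j : ℝ) + 1 / 2) * (2 * (Real.log n + c))) = -(((2 * j + 1 : ℕ) : ℝ) * (Real.log n + c)) by
    push_cast; ring, h2] at h3
  rw [mul_one_div, le_div_iff₀ (by linarith), uu, ← Real.exp_nat_mul, ← Real.exp_add]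
  calc _ = _ := by rw [pow_succ]; ring
    _ ≤ _ := h3
    _ = _ := by congr 1; push_cast; ring

lemma term_d (n : ℕ) (hn : 3 ≤ n) (c : ℝ) (k j : ℕ) (hk : ((n : ℝ) - 3 / 2) * (Real.log n + c) ≤ k) :
    (n : ℝ) ^ (2 * j + 1) * uu n (j + 1) ^ (2 * k) ≤ Real.exp (-(2 * c)) * Real.exp (-(2 * c)) ^ j * (1 / n) := by
  have hn' : (3 : ℝ) ≤ n := by exact_mod_cast hn
  have h1 := pow_exp_le ((n : ℝ) - 3 / 2) ((j : ℝ) + 1) (2 * (Real.log n + c)) (by linarith) (by positivity)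
    (2 * k) (by push_cast; linarith)
  have h2 := npow_exp n (by omega) c (2 * j + 2)
  have h3 := mul_le_mul_of_nonneg_left h1 (show (0 : ℝ) ≤ (n : ℝ) ^ (2 * j + 2) by positivity)
  rw [show -(((j : ℝ) + 1) * (2 * (Real.log n + c))) = -(((2 * j + 2 : ℕ) : ℝ) * (Real.log n + c)) by
    push_cast; ring, h2] at h3
  rw [mul_one_div, le_div_iff₀ (by linarith), uu, ← Real.exp_nat_mul, ← Real.exp_add]
  calc _ = _ := by rw [pow_succ _ (2 * j + 1)]; ring
    _ ≤ _ := h3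
    _ = _ := by congr 1; push_cast; ring

lemma term_c (n : ℕ) (hn : 3 ≤ n) (c : ℝ) (k' j : ℕ) (hj : j < n) (hk1 : 1 ≤ k')
    (hk : ((n : ℝ) - 1) * (Real.log n + c) ≤ 2 * k') :
    0 ≤ (n : ℝ) ^ (2 * j) * (ww n j ^ (4 * k' - 1) * (1 - ww n j)) ∧
    (n : ℝ) ^ (2 * j) * (ww n j ^ (4 * k' - 1) * (1 - ww n j)) ≤
      Real.exp 1 * Real.exp (-(2 * c)) ^ j * (j * (1 / ((n : ℝ) - 1))) ∧ (j : ℝ) * (1 / ((n : ℝ) - 1)) ≤ 1 := by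
  have hn' : (3 : ℝ) ≤ n := by exact_mod_cast hn
  have hj' : (j : ℝ) + 1 ≤ n := by exact_mod_cast hj
  have hm : (0 : ℝ) < n - 1 := by linarith
  have hr : (j : ℝ) / (n - 1) ≤ 1 := by rw [div_le_one hm]; linarith
  have hw1 : 1 - ww n j = (j : ℝ) / (n - 1) := by
    rw [ww, max_eq_right (by linarith)]; ring
  have hw0 : 0 ≤ ww n j := le_max_left _ _
  have hr0 : 0 ≤ (j : ℝ) / (n - 1) := by positivity
  rw [hw1, mul_one_div]
  refine ⟨by positivity, ?_, hr⟩
  have hcast : ((4 * k' - 1 : ℕ) : ℝ) = 4 * k' - 1 := by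
    rw [Nat.cast_sub (by omega)]; push_cast; ring
  have h1 := pow_exp_le ((n : ℝ) - 1) (j : ℝ) (2 * (Real.log n + c) - 1 / (n - 1)) hm (by positivity)
    (4 * k' - 1) (by
      rw [hcast, mul_sub, mul_one_div, div_self hm.ne']; linarith)
  have h2 := npow_exp n (by omega) c (2 * j)
  have h4 : Real.exp (-((j : ℝ) * (2 * (Real.log n + c) - 1 / (n - 1)))) ≤
      Real.exp 1 * Real.exp (-(((2 * j : ℕ) : ℝ) * (Real.log n + c))) := by
    rw [← Real.exp_add]
    refine Real.exp_le_exp.2 ?_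
    have : (j : ℝ) * (1 / (n - 1)) ≤ 1 := by rw [mul_one_div]; exact hr
    push_cast
    linarith
  have h3 := mul_le_mul_of_nonneg_left (h1.trans h4) (show (0 : ℝ) ≤ (n : ℝ) ^ (2 * j) by positivity)
  have e : (n : ℝ) ^ (2 * j) * (Real.exp 1 * Real.exp (-(((2 * j : ℕ) : ℝ) * (Real.log n + c)))) =
      Real.exp 1 * Real.exp (-(2 * c)) ^ j := by
    rw [mul_left_comm, h2, ← Real.exp_nat_mul]; congr 2; push_cast; ring
  rw [e] at h3
  rw [← mul_assoc]
  exact mul_le_mul_of_nonneg_right h3 hr0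

lemma term_a (n : ℕ) (hn : 3 ≤ n) (c : ℝ) (k k' j : ℕ) (hk : ((n : ℝ) - 3 / 2) * (Real.log n + c) ≤ k)
    (hk' : ((n : ℝ) - 1) * (Real.log n + c) ≤ (2 * k' : ℕ)) :
    ((n : ℝ) ^ j * uu n j ^ k - (n : ℝ) ^ j * ww n j ^ (2 * k')) ^ 2 ≤ Real.exp (-(2 * c)) ^ j := by
  have hn' : (3 : ℝ) ≤ n := by exact_mod_cast hn
  have h1 := pow_exp_le ((n : ℝ) - 3 / 2) j (Real.log n + c) (by linarith) (by positivity) k hk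
  have h2 := pow_exp_le ((n : ℝ) - 1) j (Real.log n + c) (by linarith) (by positivity) (2 * k') hk'
  have h1' := mul_le_mul_of_nonneg_left h1 (show (0 : ℝ) ≤ (n : ℝ) ^ j by positivity)
  have h2' := mul_le_mul_of_nonneg_left h2 (show (0 : ℝ) ≤ (n : ℝ) ^ j by positivity)
  rw [npow_exp n (by omega) c j] at h1' h2'
  have u0 : 0 ≤ uu n j := le_max_left _ _
  have w0 : 0 ≤ ww n j := le_max_left _ _
  have p1 : 0 ≤ (n : ℝ) ^ j * uu n j ^ k := by positivity
  have p2 : 0 ≤ (n : ℝ) ^ j * ww n j ^ (2 * k') := by positivity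
  have e : Real.exp (-(2 * c)) ^ j = Real.exp (-(j * c)) ^ 2 := by
    rw [← Real.exp_nat_mul, ← Real.exp_nat_mul]; congr 1; push_cast; ring
  rw [e]
  refine sq_le_sq' ?_ ?_
  · have : (n : ℝ) ^ j * ww n j ^ (2 * k') ≤ Real.exp (-(j * c)) := h2'
    linarith
  · have : (n : ℝ) ^ j * uu n j ^ k ≤ Real.exp (-(j * c)) := h1'
    linarith

end FinalSec

theorem scaled_l2_P_vs_P' (c : ℝ) :
    Filter.Tendsto (fun n : ℕ =>
      ((Nat.factorial n : ℝ) / 2) *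
        ∑ σ : alternatingGroup (Fin n),
          (convPow (Pmeas n) ⌈((n : ℝ) - 3 / 2) * (Real.log n + c)⌉₊ σ -
            convPow (P'meas n) ⌈(((n : ℝ) - 1) / 2) * (Real.log n + c)⌉₊ σ) ^ 2)
      Filter.atTop (nhds 0) := by
  let k : ℕ → ℕ := fun n => ⌈((n : ℝ) - 3 / 2) * (Real.log n + c)⌉₊
  let k' : ℕ → ℕ := fun n => ⌈(((n : ℝ) - 1) / 2) * (Real.log n + c)⌉₊
  have hlog : ∀ᶠ n : ℕ in atTop, -c < Real.log n :=
    (Real.tendsto_log_atTop.comp tendsto_natCast_atTop_atTop).eventually_gt_atTop _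
  have hgood : ∀ᶠ n : ℕ in atTop, 3 ≤ n ∧ 1 ≤ k' n ∧
      (((n : ℝ) - 3 / 2) * (Real.log n + c) ≤ k n ∧ (k n : ℝ) ≤ ((n : ℝ) - 3 / 2) * (Real.log n + c) + 2) ∧
      (((n : ℝ) - 1) * (Real.log n + c) ≤ (2 * k' n : ℕ) ∧
        ((2 * k' n : ℕ) : ℝ) ≤ ((n : ℝ) - 1) * (Real.log n + c) + 2) := by
    filter_upwards [hlog, eventually_ge_atTop 3] with n hL hn
    have hn' : (3 : ℝ) ≤ n := by exact_mod_cast hn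
    have hL' : 0 < Real.log n + c := by linarith
    have p1 : 0 < ((n : ℝ) - 3 / 2) * (Real.log n + c) := mul_pos (by linarith) hL'
    have p2 : 0 < (((n : ℝ) - 1) / 2) * (Real.log n + c) := mul_pos (by linarith) hL'
    have a1 := Nat.le_ceil (((n : ℝ) - 3 / 2) * (Real.log n + c))
    have a2 := Nat.ceil_lt_add_one p1.le
    have b1 := Nat.le_ceil ((((n : ℝ) - 1) / 2) * (Real.log n + c))
    have b2 := Nat.ceil_lt_add_one p2.le
    refine ⟨hn, Nat.ceil_pos.2 p2, ⟨a1, ?_⟩, ?_, ?_⟩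
    · change ((⌈((n : ℝ) - 3 / 2) * (Real.log n + c)⌉₊ : ℕ) : ℝ) ≤ _
      linarith
    · push_cast
      change _ ≤ 2 * ((⌈(((n : ℝ) - 1) / 2) * (Real.log n + c)⌉₊ : ℕ) : ℝ)
      linarith
    · push_cast
      change 2 * ((⌈(((n : ℝ) - 1) / 2) * (Real.log n + c)⌉₊ : ℕ) : ℝ) ≤ _
      linarith
  let A : ℕ → ℕ → ℝ := fun n j => ((n : ℝ) ^ j * uu n j ^ k n - (n : ℝ) ^ j * ww n j ^ (2 * k' n)) ^ 2
  let B : ℕ → ℕ → ℝ := fun n j => (n : ℝ) ^ (2 * j) * uu n (j + 1 / 2) ^ (2 * k n)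
  let C : ℕ → ℕ → ℝ := fun n j => (n : ℝ) ^ (2 * j) * (ww n j ^ (4 * k' n - 1) * (1 - ww n j))
  let D : ℕ → ℕ → ℝ := fun n j => (n : ℝ) ^ (2 * j + 1) * uu n (j + 1) ^ (2 * k n)
  let F : ℕ → ℕ → ℝ := fun n j => 2 / (j.factorial : ℝ) * (A n j + 2 * B n j + 4 * C n j + 2 * D n j)
  let X : ℝ := Real.exp (-(2 * c))
  have hu0 : ∀ n t, 0 ≤ uu n t := fun n t => le_max_left _ _
  have hB0 : ∀ n j, 0 ≤ B n j := fun n j => by have := hu0 n (j + 1 / 2); positivity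
  have hD0 : ∀ n j, 0 ≤ D n j := fun n j => by have := hu0 n (j + 1); positivity
  have hA0 : ∀ n j, 0 ≤ A n j := fun n j => sq_nonneg _
  have hX : 0 < X := Real.exp_pos _
  have h1n : Tendsto (fun n : ℕ => (1 : ℝ) / (n : ℝ)) atTop (nhds 0) := tendsto_one_div_atTop_nhds_zero_nat
  have h1n1 : Tendsto (fun n : ℕ => (1 : ℝ) / ((n : ℝ) - 1)) atTop (nhds 0) := by
    have : Tendsto (fun n : ℕ => (n : ℝ) - 1) atTop atTop :=
      tendsto_atTop_add_const_right _ (-1) tendsto_natCast_atTop_atTop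
    simp only [one_div]
    exact this.inv_tendsto_atTop
  have hlim : ∀ j, Tendsto (fun n => F n j) atTop (nhds 0) := by
    intro j
    have lA : Tendsto (fun n => A n j) atTop (nhds 0) := by
      have l1 := lim_pow c (3 / 2) j k (hgood.mono fun n h => h.2.2.1)
      have l2 := lim_pow c 1 j (fun n => 2 * k' n) (hgood.mono fun n h => h.2.2.2)
      have := (l1.sub l2).pow 2
      rw [sub_self, zero_pow two_ne_zero] at this
      exact this
    have lB : Tendsto (fun n => B n j) atTop (nhds 0) := by
      refine squeeze_zero' (Eventually.of_forall fun n => hB0 n j)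
        (hgood.mono fun n h => term_b n h.1 c (k n) j h.2.2.1.1) ?_
      simpa using h1n.const_mul (Real.exp (-c) * Real.exp (-(2 * c)) ^ j)
    have lD : Tendsto (fun n => D n j) atTop (nhds 0) := by
      refine squeeze_zero' (Eventually.of_forall fun n => hD0 n j)
        (hgood.mono fun n h => term_d n h.1 c (k n) j h.2.2.1.1) ?_
      simpa using h1n.const_mul (Real.exp (-(2 * c)) * Real.exp (-(2 * c)) ^ j)
    have hc : ∀ᶠ n : ℕ in atTop, _ := (hgood.and (eventually_gt_atTop j)).mono fun n h =>
      term_c n h.1.1 c (k' n) j h.2 h.1.2.1 (by simpa using h.1.2.2.2.1)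
    have lC : Tendsto (fun n => C n j) atTop (nhds 0) := by
      refine squeeze_zero' (hc.mono fun n h => h.1) (hc.mono fun n h => h.2.1) ?_
      simpa using (h1n1.const_mul (j : ℝ)).const_mul (Real.exp 1 * Real.exp (-(2 * c)) ^ j)
    have := ((((lA.add (lB.const_mul 2)).add (lC.const_mul 4)).add (lD.const_mul 2))).const_mul
      (2 / (j.factorial : ℝ))
    simpa using this
  let M : ℝ := 2 * (1 + 2 * Real.exp (-c) + 4 * Real.exp 1 + 2 * X)
  have hsum : Tendsto (fun n => ∑ j ∈ Finset.range n, F n j) atTop (nhds 0) := by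
    refine sum_dom F (fun j => M * (X ^ j / j.factorial)) ((Real.summable_pow_div_factorial X).mul_left M)
      ?_ (fun j => by positivity) hlim
    filter_upwards [hgood] with n h j hj
    have hn' : (3 : ℝ) ≤ n := by exact_mod_cast h.1
    have a := term_a n h.1 c (k n) (k' n) j h.2.2.1.1 h.2.2.2.1
    have b := term_b n h.1 c (k n) j h.2.2.1.1
    have d := term_d n h.1 c (k n) j h.2.2.1.1
    obtain ⟨c0, c1, c2⟩ := term_c n h.1 c (k' n) j hj h.2.1 (by simpa using h.2.2.2.1)
    have hX' : 0 < X ^ j := by positivity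
    have hle : (1 : ℝ) / n ≤ 1 := by rw [div_le_one (by linarith)]; linarith
    have b' : B n j ≤ Real.exp (-c) * X ^ j := b.trans (mul_le_of_le_one_right (by positivity) hle)
    have d' : D n j ≤ X * X ^ j := d.trans (mul_le_of_le_one_right (by positivity) hle)
    have c' : C n j ≤ Real.exp 1 * X ^ j := c1.trans (mul_le_of_le_one_right (by positivity) c2)
    have a' : A n j ≤ X ^ j := a
    have c0' : 0 ≤ C n j := c0
    have hA := hA0 n j
    have hB := hB0 n j
    have hD := hD0 n j
    have hf : 0 ≤ F n j := by
      simp only [F]; positivity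
    rw [abs_of_nonneg hf]
    have : M * (X ^ j / j.factorial) = 2 / (j.factorial : ℝ) *
        (X ^ j + 2 * (Real.exp (-c) * X ^ j) + 4 * (Real.exp 1 * X ^ j) + 2 * (X * X ^ j)) := by
      simp only [M]; field_simp
    rw [this]
    refine mul_le_mul_of_nonneg_left ?_ (by positivity)
    linarith
  refine squeeze_zero' (Eventually.of_forall fun n => ?_) ?_ hsum
  · exact mul_nonneg (by positivity) (Finset.sum_nonneg fun _ _ => sq_nonneg _)
  filter_upwards [hgood] with n h
  have hfin := finite_bound h.1 (k n) (k' n) h.2.1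
  have hnn : 0 ≤ (n.factorial : ℝ) * ∑ σ : alternatingGroup (Fin n),
      (convPow (Pmeas n) (k n) σ - convPow (P'meas n) (k' n) σ) ^ 2 :=
    mul_nonneg (by positivity) (Finset.sum_nonneg fun _ _ => sq_nonneg _)
  have hdrop : ∑ j ∈ Finset.range (n - 1), 2 * ((n : ℝ) ^ (2 * j + 1) / j.factorial) * (2 * uu n (j + 1) ^ (2 * k n))
      ≤ ∑ j ∈ Finset.range n, 2 * ((n : ℝ) ^ (2 * j + 1) / j.factorial) * (2 * uu n (j + 1) ^ (2 * k n)) := by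
    refine Finset.sum_le_sum_of_subset_of_nonneg (Finset.range_subset_range.2 (by omega)) fun j _ _ => ?_
    have := hu0 n (j + 1)
    positivity
  have heq : ∑ j ∈ Finset.range n, F n j = (∑ j ∈ Finset.range n, 2 * ((n : ℝ) ^ (2 * j) / j.factorial) *
      ((uu n j ^ k n - ww n j ^ (2 * k' n)) ^ 2 + 2 * uu n (j + 1 / 2) ^ (2 * k n)
        + 4 * (ww n j ^ (4 * k' n - 1) * (1 - ww n j)))) +
      ∑ j ∈ Finset.range n, 2 * ((n : ℝ) ^ (2 * j + 1) / j.factorial) * (2 * uu n (j + 1) ^ (2 * k n)) := by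
    rw [← Finset.sum_add_distrib]
    refine Finset.sum_congr rfl fun j _ => ?_
    simp only [F, A, B, C, D]
    rw [← mul_sub, mul_pow, ← pow_mul, mul_comm j 2]
    ring
  have hgoal : (n.factorial : ℝ) * ∑ σ : alternatingGroup (Fin n),
      (convPow (Pmeas n) (k n) σ - convPow (P'meas n) (k' n) σ) ^ 2 ≤ ∑ j ∈ Finset.range n, F n j := by
    rw [heq]; linarith
  change (n.factorial : ℝ) / 2 * ∑ σ : alternatingGroup (Fin n),
      (convPow (Pmeas n) (k n) σ - convPow (P'meas n) (k' n) σ) ^ 2 ≤ _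
  linarith
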